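/- arXiv:1306.3967 — 10 statements merged into one kernel-verified Lean document; each statement's English description precedes it below -/
import Mathlib

section
/- Let F be a field and let A be an m×m matrix over F. The centralizer of A in M_m(F) is a subfield of M_m(F) (i.e., a commutative ring in which every nonzero element is invertible, containing the scalar matrices) if and only if A is similar over F to the companion matrix of a monic irreducible polynomial in F[X] of degree m. -/
open Polynomial

/-- The companion matrix of a monic polynomial `g` of degree `m`:
ones on the subdiagonal, negatives of the coefficients of `g` in the last column. -/
def companionMatrix {F : Type*} [Field F] (m : ℕ) (g : Polynomial F) :
    Matrix (Fin m) (Fin m) F :=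
  Matrix.of fun i j =>
    if (i : ℕ) = (j : ℕ) + 1 then 1 else if (j : ℕ) = m - 1 then -g.coeff i else 0

open Matrix

/-- The Krylov matrix of `A` and `v`, with columns `v, A v, …, A ^ (m - 1) v`. -/
def krylovMatrix {F : Type*} [Field F] {m : ℕ} (A : Matrix (Fin m) (Fin m) F) (v : Fin m → F) :
    Matrix (Fin m) (Fin m) F :=
  Matrix.of fun i j => ((A ^ (j : ℕ)) *ᵥ v) i

section Krylov

variable {F : Type*} [Field F] {m : ℕ}

lemma commute_aeval_self (A : Matrix (Fin m) (Fin m) F) (q : F[X]) : Commute A (aeval A q) := by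
  simpa using (Commute.all X q).map (aeval A)

lemma mul_krylovMatrix_of_commute {A B : Matrix (Fin m) (Fin m) F} (h : Commute A B)
    (v : Fin m → F) : B * krylovMatrix A v = krylovMatrix A (B *ᵥ v) := by
  ext i j
  change (B *ᵥ ((A ^ (j : ℕ)) *ᵥ v)) i = ((A ^ (j : ℕ)) *ᵥ (B *ᵥ v)) i
  rw [mulVec_mulVec, mulVec_mulVec, (h.pow_left j).eq]

lemma krylovMatrix_zero (A : Matrix (Fin m) (Fin m) F) : krylovMatrix A 0 = 0 := by
  ext i j
  simp [krylovMatrix]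

lemma krylovMatrix_mulVec (A : Matrix (Fin m) (Fin m) F) (v w : Fin m → F) :
    krylovMatrix A v *ᵥ w = ∑ j, w j • ((A ^ (j : ℕ)) *ᵥ v) := by
  ext i
  simp [krylovMatrix, mulVec_eq_sum]

lemma krylovMatrix_mulVec_coeff (A : Matrix (Fin m) (Fin m) F) (v : Fin m → F) {q : F[X]}
    (hq : q.degree < m) :
    krylovMatrix A v *ᵥ (fun j => q.coeff j) = aeval A q *ᵥ v := by
  rw [krylovMatrix_mulVec]
  rcases Nat.eq_zero_or_pos m with rfl | hm
  · exact Subsingleton.elim _ _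
  · have hq' : q.natDegree < m := by
      rcases eq_or_ne q 0 with rfl | h0
      · simpa using hm
      · exact (natDegree_lt_iff_degree_lt h0).2 hq
    rw [aeval_eq_sum_range' hq', sum_mulVec, ← Fin.sum_univ_eq_sum_range
      (fun k => (q.coeff k • A ^ k) *ᵥ v)]
    simp [smul_mulVec]

lemma krylovMatrix_mul_companionMatrix (A : Matrix (Fin m) (Fin m) F) (v : Fin m → F)
    {g : F[X]} (hg : g.Monic) (hd : g.natDegree = m) (i j : Fin m) :
    (krylovMatrix A v * companionMatrix m g) i j =
      ((A ^ ((j : ℕ) + 1)) *ᵥ v - if (j : ℕ) = m - 1 then aeval A g *ᵥ v else 0) i := by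
  change (krylovMatrix A v *ᵥ (fun k => companionMatrix m g k j)) i = _
  have hj := j.isLt
  split_ifs with h
  · have hcol : (fun k => companionMatrix m g k j) = fun k : Fin m => (X ^ m - g : F[X]).coeff k := by
      ext k
      have hk := k.isLt
      simp [companionMatrix, h, show m - 1 + 1 = m by lia, hk.ne, coeff_X_pow]
    have hdeg : (X ^ m - g : F[X]).degree < m := by
      have := degree_sub_lt_left (p := X ^ m) (q := g)
        (by rw [degree_X_pow, degree_eq_natDegree hg.ne_zero, hd])
        (by simp) (by simp [hg.leadingCoeff])
      simpa using this
    rw [hcol, krylovMatrix_mulVec_coeff A v hdeg, show (j : ℕ) + 1 = m by lia]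
    simp [sub_mulVec]
  · have hcol : (fun k => companionMatrix m g k j) =
        fun k : Fin m => (X ^ ((j : ℕ) + 1) : F[X]).coeff k := by
      ext k
      simp [companionMatrix, h, coeff_X_pow]
    rw [hcol, krylovMatrix_mulVec_coeff A v (by rw [degree_X_pow]; exact_mod_cast (by lia))]
    simp

lemma mul_krylovMatrix_eq_mul_companionMatrix {A : Matrix (Fin m) (Fin m) F} {v : Fin m → F}
    {g : F[X]} (hg : g.Monic) (hd : g.natDegree = m) (h : aeval A g *ᵥ v = 0) :
    A * krylovMatrix A v = krylovMatrix A v * companionMatrix m g := by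
  ext i j
  rw [krylovMatrix_mul_companionMatrix A v hg hd, h]
  change (A *ᵥ ((A ^ (j : ℕ)) *ᵥ v)) i = _
  simp [mulVec_mulVec, pow_succ']

/-- A matrix intertwining `A` with a companion matrix is a Krylov matrix. -/
lemma eq_krylovMatrix_of_mul_eq (hm : 1 ≤ m) {A P : Matrix (Fin m) (Fin m) F} {g : F[X]}
    (h : A * P = P * companionMatrix m g) : P = krylovMatrix A (fun i => P i ⟨0, hm⟩) := by
  suffices ∀ (j : ℕ) (hj : j < m),
      (fun i => P i ⟨j, hj⟩) = (A ^ j) *ᵥ (fun i => P i ⟨0, hm⟩) by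
    ext i j
    exact congrFun (this j j.isLt) i
  intro j
  induction j with
  | zero => simp
  | succ j ih =>
    intro hj
    rw [pow_succ', ← mulVec_mulVec, ← ih (by lia)]
    ext i
    change _ = (A * P) i ⟨j, by lia⟩
    rw [h, mul_apply, Finset.sum_eq_single ⟨j + 1, hj⟩]
    · simp [companionMatrix]
    · intro k _ hk
      have : (k : ℕ) ≠ j + 1 := fun e => hk (Fin.ext e)
      simp [companionMatrix, this, show j ≠ m - 1 by lia]
    · simp

lemma aeval_eq_zero_of_mul_eq (hm : 1 ≤ m) {A : Matrix (Fin m) (Fin m) F} {v : Fin m → F}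
    {g : F[X]} (hg : g.Monic) (hd : g.natDegree = m) (hK : IsUnit (krylovMatrix A v))
    (h : A * krylovMatrix A v = krylovMatrix A v * companionMatrix m g) : aeval A g = 0 := by
  have hv : aeval A g *ᵥ v = 0 := by
    ext i
    have := congrFun (congrFun h i) ⟨m - 1, by lia⟩
    rw [krylovMatrix_mul_companionMatrix A v hg hd] at this
    change (A *ᵥ ((A ^ (m - 1)) *ᵥ v)) i = _ at this
    rw [mulVec_mulVec, ← pow_succ'] at this
    rw [if_pos rfl, Pi.sub_apply, eq_comm, sub_eq_self] at this
    exact this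
  refine hK.mul_left_eq_zero.1 ?_
  rw [mul_krylovMatrix_of_commute (commute_aeval_self A g), hv, krylovMatrix_zero]

/-- If `A` has a cyclic vector, its centralizer consists of polynomials in `A`. -/
lemma exists_aeval_eq_of_commute {A B : Matrix (Fin m) (Fin m) F} {v : Fin m → F}
    (hK : IsUnit (krylovMatrix A v)) (hB : Commute A B) :
    ∃ q : F[X], q.degree < m ∧ aeval A q = B := by
  obtain ⟨w, hw⟩ := mulVec_surjective_iff_isUnit.2 hK (B *ᵥ v)
  let q : F[X] := ∑ j : Fin m, monomial (j : ℕ) (w j)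
  have hq : q.degree < m := by
    refine (degree_sum_le _ _).trans_lt ((Finset.sup_lt_iff (WithBot.bot_lt_coe m)).2 ?_)
    intro j _
    exact (degree_monomial_le _ _).trans_lt (Nat.cast_lt.2 j.isLt)
  have hc : (fun j : Fin m => q.coeff j) = w := by
    ext j
    simp [q, coeff_monomial, Fin.val_inj]
  refine ⟨q, hq, hK.mul_left_injective ?_⟩
  change aeval A q * krylovMatrix A v = B * krylovMatrix A v
  rw [mul_krylovMatrix_of_commute hB,
    mul_krylovMatrix_of_commute (commute_aeval_self A q),
    ← krylovMatrix_mulVec_coeff A v hq, hc, hw]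

lemma irreducible_minpoly_of_isUnit_of_commute (hm : 1 ≤ m) {A : Matrix (Fin m) (Fin m) F}
    (h : ∀ B, Commute A B → B ≠ 0 → IsUnit B) : Irreducible (minpoly F A) := by
  have : Nonempty (Fin m) := ⟨⟨0, hm⟩⟩
  have hA : IsIntegral F A := Algebra.IsIntegral.isIntegral A
  refine (irreducible_of_monic (minpoly.monic hA) (minpoly.ne_one F A)).2 fun f g hf hg he => ?_
  rw [← hf.isUnit_iff, ← hg.isUnit_iff]
  by_contra! hfg
  have heval := congrArg (aeval A) he
  rw [map_mul, minpoly.aeval] at heval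
  have hf0 := minpoly.aeval_ne_zero_of_dvdNotUnit_minpoly hA hf ⟨hf.ne_zero, g, hfg.2, he.symm⟩
  have hg0 := minpoly.aeval_ne_zero_of_dvdNotUnit_minpoly hA hg
    ⟨hg.ne_zero, f, hfg.1, ((mul_comm g f).trans he).symm⟩
  have hu := h _ (commute_aeval_self A f) hf0
  exact hg0 (hu.mul_right_eq_zero.1 heval)

/-- If every nonzero matrix commuting with `A` is invertible, then every `A`-invariant subspace
is trivial. -/
lemma invtSubmodule_eq_bot_or_top (hm : 1 ≤ m) {A : Matrix (Fin m) (Fin m) F}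
    (h : ∀ B, Commute A B → B ≠ 0 → IsUnit B) {W : Submodule F (Fin m → F)}
    (hW : W ∈ Module.End.invtSubmodule (toLin' A)) : W = ⊥ ∨ W = ⊤ := by
  have hss : Module.End.IsSemisimple (toLin' A) :=
    Module.End.isSemisimple_of_squarefree_aeval_eq_zero
      (irreducible_minpoly_of_isUnit_of_commute hm h).squarefree
      (by rw [← Matrix.minpoly_toLin']; exact minpoly.aeval F _)
  obtain ⟨U, hU, hc⟩ := Module.End.isSemisimple_iff.1 hss W hW
  have hcomm : Commute (W.projection U hc) (toLin' A) := by
    rw [LinearMap.IsIdempotentElem.commute_iff (Submodule.isIdempotentElem_projection hc)]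
    simpa using ⟨hW, hU⟩
  let B := LinearMap.toMatrix' (W.projection U hc)
  have hB : toLin' B = W.projection U hc := toLin'_toMatrix' _
  have hAB : Commute A B := by
    apply toLin'.injective
    rw [toLin'_mul, toLin'_mul, hB]
    exact hcomm.symm.eq
  rcases eq_or_ne B 0 with h0 | h0
  · left
    rw [← Submodule.range_projection hc, ← hB, h0, map_zero, LinearMap.range_zero]
  · right
    rw [← Submodule.range_projection hc, ← hB, LinearMap.range_eq_top]
    exact mulVec_surjective_iff_isUnit.2 (h B hAB h0)

lemma isUnit_krylovMatrix (hm : 1 ≤ m) {A : Matrix (Fin m) (Fin m) F}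
    (h : ∀ B, Commute A B → B ≠ 0 → IsUnit B) {v : Fin m → F} (hv : v ≠ 0) :
    IsUnit (krylovMatrix A v) := by
  have hinv : LinearMap.range (toLin' (krylovMatrix A v)) ∈
      Module.End.invtSubmodule (toLin' A) := by
    rw [Module.End.mem_invtSubmodule]
    rintro _ ⟨w, rfl⟩
    refine ⟨companionMatrix m A.charpoly *ᵥ w, ?_⟩
    simp only [toLin'_apply, mulVec_mulVec]
    rw [mul_krylovMatrix_eq_mul_companionMatrix A.charpoly_monic
      (by simp [charpoly_natDegree_eq_dim]) (by simp [aeval_self_charpoly])]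
  rcases invtSubmodule_eq_bot_or_top hm h hinv with h0 | h1
  · refine absurd ?_ hv
    have h0 := LinearMap.range_eq_bot.1 h0
    have : krylovMatrix A v = 0 := by simpa using h0
    ext i
    simpa [krylovMatrix] using congrFun (congrFun this i) ⟨0, hm⟩
  · rw [← mulVec_surjective_iff_isUnit]
    exact LinearMap.range_eq_top.1 h1

lemma charpoly_eq_minpoly_of_isUnit_krylovMatrix (hm : 1 ≤ m) {A : Matrix (Fin m) (Fin m) F}
    {v : Fin m → F} (hK : IsUnit (krylovMatrix A v)) : A.charpoly = minpoly F A := by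
  have : Nonempty (Fin m) := ⟨⟨0, hm⟩⟩
  have hA : IsIntegral F A := Algebra.IsIntegral.isIntegral A
  refine eq_of_monic_of_dvd_of_natDegree_le (minpoly.monic hA) A.charpoly_monic
    (minpoly.dvd F A A.aeval_self_charpoly) ?_
  rw [charpoly_natDegree_eq_dim, Fintype.card_fin]
  by_contra! hlt
  have h0 : krylovMatrix A v *ᵥ (fun j => (minpoly F A).coeff j) = krylovMatrix A v *ᵥ 0 := by
    rw [krylovMatrix_mulVec_coeff A v
      ((natDegree_lt_iff_degree_lt (minpoly.ne_zero hA)).1 hlt)]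
    simp
  have := congrFun (mulVec_injective_iff_isUnit.2 hK h0) ⟨_, hlt⟩
  simp [(minpoly.monic hA).coeff_natDegree] at this

/-- A nonzero polynomial in `A` is invertible if `A` is a root of an irreducible polynomial of
larger degree. -/
lemma isUnit_aeval_of_irreducible {A : Matrix (Fin m) (Fin m) F} {g q : F[X]}
    (hg : Irreducible g) (hA : aeval A g = 0) (hq : q ≠ 0) (hd : q.degree < g.degree) :
    IsUnit (aeval A q) := by
  have hcop : IsCoprime g q :=
    hg.coprime_iff_not_dvd.2 fun hdvd => (degree_le_of_dvd hdvd hq).not_gt hd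
  obtain ⟨a, b, hab⟩ := hcop
  refine IsUnit.of_mul_eq_one_right (aeval A b) ?_
  simpa [hA] using congrArg (aeval A) hab

end Krylov

/-- The centralizer of `A` in `M_m(F)` is a subfield of `M_m(F)` (i.e. it is commutative
and every nonzero element of it is invertible) if and only if `A` is similar over `F` to
the companion matrix of a monic irreducible polynomial of degree `m`. -/
theorem stmt0 {F : Type*} [Field F] {m : ℕ} (hm : 1 ≤ m)
    (A : Matrix (Fin m) (Fin m) F) :
    ((∀ B C : Matrix (Fin m) (Fin m) F,
        A * B = B * A → A * C = C * A → B * C = C * B) ∧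
     (∀ B : Matrix (Fin m) (Fin m) F, A * B = B * A → B ≠ 0 → IsUnit B)) ↔
    (∃ g : Polynomial F, g.Monic ∧ Irreducible g ∧ g.natDegree = m ∧
      ∃ P : (Matrix (Fin m) (Fin m) F)ˣ,
        A = (P : Matrix (Fin m) (Fin m) F) * companionMatrix m g * ((P⁻¹ : (Matrix (Fin m) (Fin m) F)ˣ) : Matrix (Fin m) (Fin m) F)) := by
  constructor
  · rintro ⟨-, h⟩
    have h' : ∀ B, Commute A B → B ≠ 0 → IsUnit B := fun B hB => h B hB.eq
    have hv : Pi.single (M := fun _ : Fin m => F) ⟨0, hm⟩ 1 ≠ 0 := by simp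
    have hK := isUnit_krylovMatrix hm h' hv
    have hd : A.charpoly.natDegree = m := by simp [charpoly_natDegree_eq_dim]
    refine ⟨A.charpoly, A.charpoly_monic, ?_, hd, hK.unit, ?_⟩
    · rw [charpoly_eq_minpoly_of_isUnit_krylovMatrix hm hK]
      exact irreducible_minpoly_of_isUnit_of_commute hm h'
    · rw [Units.eq_mul_inv_iff_mul_eq, IsUnit.unit_spec]
      exact mul_krylovMatrix_eq_mul_companionMatrix A.charpoly_monic hd
        (by rw [aeval_self_charpoly, zero_mulVec])
  · rintro ⟨g, hg, hirr, hd, P, hP⟩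
    rw [Units.eq_mul_inv_iff_mul_eq] at hP
    have hPK := eq_krylovMatrix_of_mul_eq hm hP
    have hK := hPK ▸ P.isUnit
    have hA : aeval A g = 0 := aeval_eq_zero_of_mul_eq hm hg hd hK (hPK ▸ hP)
    refine ⟨fun B C hB hC => ?_, fun B hB hB0 => ?_⟩
    · obtain ⟨p, -, rfl⟩ := exists_aeval_eq_of_commute hK hB
      obtain ⟨q, -, rfl⟩ := exists_aeval_eq_of_commute hK hC
      rw [← map_mul, mul_comm, map_mul]
    · obtain ⟨q, hq, rfl⟩ := exists_aeval_eq_of_commute hK hB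
      refine isUnit_aeval_of_irreducible hirr hA (by rintro rfl; simp at hB0) ?_
      rwa [degree_eq_natDegree hg.ne_zero, hd]
end

section
/- Let F be a field and A an m×m matrix over F whose centralizer is a subfield of M_m(F). Suppose ad A has a nonzero eigenvalue b ∈ F (i.e., there is a nonzero X ∈ M_m(F) with AX − XA = bX). Then F has prime characteristic p, every eigenvector of ad A for the eigenvalue b is an invertible matrix, and the eigenspace of ad A for the eigenvalue b has the same F-dimension as the centralizer of A (which is the eigenspace for the eigenvalue 0). -/
open Polynomial

/-- The adjoint operator `ad A : B ↦ AB - BA` on `M_m(F)`, as an `F`-linear endomorphism. -/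
noncomputable def adMat {F : Type*} [Field F] {m : ℕ} (A : Matrix (Fin m) (Fin m) F) :
    Module.End F (Matrix (Fin m) (Fin m) F) :=
  LinearMap.mulLeft F A - LinearMap.mulRight F A

/-- The minimal polynomial of an element is squarefree if every nonzero element commuting with it
is a unit. -/
theorem squarefree_minpoly_of_forall_commute_isUnit {F R : Type*} [Field F] [Ring R] [Algebra F R]
    {a : R} (ha : IsIntegral F a) (h : ∀ g : R, Commute a g → g ≠ 0 → IsUnit g) :
    Squarefree (minpoly F a) := by
  rintro x ⟨q, hq⟩
  have h0 : aeval a x * aeval a (x * q) = 0 := by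
    rw [← map_mul, ← mul_assoc, ← hq, minpoly.aeval]
  have hne : x * (x * q) ≠ 0 := by
    rw [← mul_assoc, ← hq]
    exact minpoly.ne_zero ha
  by_cases hx : aeval a x = 0
  · obtain ⟨r, hr⟩ := minpoly.dvd F a hx
    refine .of_mul_eq_one (q * r) (mul_left_cancel₀ (left_ne_zero_of_mul hne) ?_)
    linear_combination -hr - r * hq
  · have hu := h _ (by simpa using (Commute.all X x).map (aeval a)) hx
    obtain ⟨r, hr⟩ := minpoly.dvd F a (hu.mul_right_eq_zero.mp h0)
    refine .of_mul_eq_one r (mul_left_cancel₀ (right_ne_zero_of_mul hne) ?_)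
    linear_combination -hr - r * hq

/-- If every nonzero endomorphism commuting with `f` is invertible, then `f` has no nontrivial
invariant subspaces. -/
theorem Module.End.eq_bot_or_eq_top_of_mem_invtSubmodule {F V : Type*} [Field F] [AddCommGroup V]
    [Module F V] [FiniteDimensional F V] {f : Module.End F V}
    (h : ∀ g : Module.End F V, Commute f g → g ≠ 0 → IsUnit g)
    {W : Submodule F V} (hW : W ∈ f.invtSubmodule) : W = ⊥ ∨ W = ⊤ := by
  have hs : f.IsSemisimple := isSemisimple_of_squarefree_aeval_eq_zero
    (squarefree_minpoly_of_forall_commute_isUnit (Algebra.IsIntegral.isIntegral f) h)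
    (minpoly.aeval F f)
  obtain ⟨W', hW', hc⟩ := isSemisimple_iff.mp hs W hW
  have hcomm : Commute f (W.projection W' hc) :=
    ((LinearMap.IsIdempotentElem.commute_iff (Submodule.isIdempotentElem_projection hc)).mpr
      (by simpa using ⟨hW, hW'⟩)).symm
  by_cases h0 : W.projection W' hc = 0
  · left
    rw [← Submodule.range_projection hc, h0, LinearMap.range_zero]
  · right
    rw [← Submodule.range_projection hc, LinearMap.range_eq_top]
    exact ((Module.End.isUnit_iff _).mp (h _ hcomm h0)).2

/-- If every nonzero matrix commuting with `A` is invertible, then so is every eigenvector of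
`ad A`. -/
theorem Matrix.isUnit_of_mul_sub_mul_eq_smul {F n : Type*} [Field F] [Fintype n] [DecidableEq n]
    {A Y : Matrix n n F} (hinv : ∀ B : Matrix n n F, A * B = B * A → B ≠ 0 → IsUnit B)
    {b : F} (hY : A * Y - Y * A = b • Y) (hY0 : Y ≠ 0) : IsUnit Y := by
  let e := Matrix.toLinAlgEquiv' (R := F) (n := n)
  have h : ∀ g : Module.End F (n → F), Commute (e A) g → g ≠ 0 → IsUnit g := by
    intro g hg hg0
    have := hinv (e.symm g) (e.injective (by simpa using hg.eq)) (by simpa using hg0)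
    simpa using this.map e
  have hYA : ∀ v, Y.mulVec v = 0 → Y.mulVec (A.mulVec v) = 0 := by
    intro v hv
    have := congrArg (Matrix.mulVec · v) hY
    simpa [Matrix.sub_mulVec, ← Matrix.mulVec_mulVec, Matrix.smul_mulVec, hv] using this
  have hker : LinearMap.ker (e Y) ∈ Module.End.invtSubmodule (e A) := fun v hv ↦ by
    simpa [e] using hYA v (by simpa [e] using hv)
  rw [← isUnit_map_iff e, LinearMap.isUnit_iff_ker_eq_bot]
  refine (Module.End.eq_bot_or_eq_top_of_mem_invtSubmodule h hker).resolve_right fun ht ↦ hY0 ?_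
  rw [LinearMap.ker_eq_top] at ht
  simpa using ht

/-- Suppose the centralizer of `A` is a subfield of `M_m(F)` (commutative, with every nonzero
element invertible), and `ad A` has a nonzero eigenvalue `b ∈ F`.  Then `F` has prime
characteristic `p`, every eigenvector of `ad A` for the eigenvalue `b` is invertible, and the
`b`-eigenspace of `ad A` has the same `F`-dimension as the centralizer of `A`, which is the
`0`-eigenspace of `ad A`. -/
theorem stmt3 {F : Type*} [Field F] {m : ℕ} (hm : 1 ≤ m)
    (A : Matrix (Fin m) (Fin m) F)
    (hcomm : ∀ B C : Matrix (Fin m) (Fin m) F,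
      A * B = B * A → A * C = C * A → B * C = C * B)
    (hinv : ∀ B : Matrix (Fin m) (Fin m) F, A * B = B * A → B ≠ 0 → IsUnit B)
    (b : F) (hb : b ≠ 0)
    (X0 : Matrix (Fin m) (Fin m) F) (hX0 : X0 ≠ 0) (hXb : A * X0 - X0 * A = b • X0) :
    (∃ p : ℕ, p.Prime ∧ CharP F p) ∧
    (∀ Y : Matrix (Fin m) (Fin m) F, A * Y - Y * A = b • Y → Y ≠ 0 → IsUnit Y) ∧
    Module.finrank F (LinearMap.ker (adMat A - b • LinearMap.id)) =
      Module.finrank F (LinearMap.ker (adMat A)) := by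
  have hunit : ∀ Y : Matrix (Fin m) (Fin m) F, A * Y - Y * A = b • Y → Y ≠ 0 → IsUnit Y :=
    fun Y ↦ Matrix.isUnit_of_mul_sub_mul_eq_smul hinv
  obtain ⟨u, rfl⟩ := hunit X0 hXb hX0
  refine ⟨?_, hunit, ?_⟩
  · have hconj : A - u.val * A * u⁻¹.val = b • 1 := by
      have := congrArg (· * u⁻¹.val) hXb
      simpa [sub_mul, mul_assoc] using this
    have htr := congrArg Matrix.trace hconj
    rw [Matrix.trace_sub, Matrix.trace_mul_cycle, Units.inv_mul, one_mul, sub_self,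
      Matrix.trace_smul, Matrix.trace_one, Fintype.card_fin, smul_eq_mul] at htr
    have hm0 : (m : F) = 0 := (mul_eq_zero.mp htr.symm).resolve_left hb
    obtain h | ⟨p, hp, h⟩ := CharP.exists' F
    · exact absurd (Nat.cast_eq_zero.mp hm0) (by lia)
    · exact ⟨p, hp.out, h⟩
  · let e := u.mulRightLinearEquiv F
    have hcomap : LinearMap.ker (adMat A) =
        (LinearMap.ker (adMat A - b • LinearMap.id)).comap e.toLinearMap := by
      ext Z
      have hZ : (adMat A - b • LinearMap.id : Module.End F _) (e Z) = e (adMat A Z) := by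
        have hu : b • u.val = A * u.val - u.val * A := hXb.symm
        simp only [adMat, e, LinearMap.sub_apply, LinearMap.smul_apply, LinearMap.id_apply,
          LinearMap.mulLeft_apply, LinearMap.mulRight_apply, Units.mulRightLinearEquiv_apply,
          ← mul_smul_comm, hu]
        noncomm_ring
      rw [Submodule.mem_comap, LinearMap.mem_ker, LinearMap.mem_ker, LinearEquiv.coe_coe, hZ,
        e.map_eq_zero_iff]
    rw [hcomap]
    exact (e.ofSubmodule' _).finrank_eq.symm
end

section
/- Let F be a field of prime characteristic p, let e ≥ 0, let n be an integer with 1 ≤ n ≤ p^e, and let α, β ∈ F. Then the Kronecker sum J_n(α) ⊗ I_{p^e} + I_n ⊗ J_{p^e}(β), an (n·p^e)×(n·p^e) matrix over F, is similar over F to the block-diagonal direct sum of n copies of the Jordan block J_{p^e}(α + β). Equivalently, the tensor product of an indecomposable n-dimensional module and an indecomposable p^e-dimensional module for a 1-dimensional Lie algebra (with eigenvalues α and β respectively) decomposes as a direct sum of n indecomposable modules, each of dimension p^e with eigenvalue α + β. -/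
open Polynomial Kronecker

/-- The `k × k` upper-triangular Jordan block with eigenvalue `lam`. -/
def jordanBlock {F : Type*} [Field F] (k : ℕ) (lam : F) : Matrix (Fin k) (Fin k) F :=
  Matrix.of fun i j => if i = j then lam else if (i : ℕ) + 1 = (j : ℕ) then 1 else 0

theorem jordanBlock_eq_smul_one_add {F : Type*} [Field F] (k : ℕ) (lam : F) :
    jordanBlock k lam = lam • (1 : Matrix (Fin k) (Fin k) F) + jordanBlock k 0 := by
  ext i j
  by_cases h : i = j <;> simp [jordanBlock, h]

theorem jordanBlock_zero_pow_apply {F : Type*} [Field F] (k l : ℕ) (i j : Fin k) :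
    (jordanBlock k (0 : F) ^ l) i j = if (i : ℕ) + l = (j : ℕ) then 1 else 0 := by
  induction l generalizing i with
  | zero => simp [Matrix.one_apply, Fin.ext_iff]
  | succ l ih =>
    rw [pow_succ', Matrix.mul_apply]
    simp only [ih]
    by_cases h : (i : ℕ) + 1 < k
    · rw [Finset.sum_eq_single ⟨(i : ℕ) + 1, h⟩]
      · have h' : i ≠ ⟨(i : ℕ) + 1, h⟩ := by simp [Fin.ext_iff]
        simp [jordanBlock, h', add_assoc, add_comm 1 l]
      · intro b _ hb
        have hb' : (i : ℕ) + 1 ≠ b := fun h2 => hb (Fin.ext h2.symm)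
        simp [jordanBlock, hb']
      · simp
    · rw [if_neg (by have := j.isLt; omega)]
      refine Finset.sum_eq_zero fun b _ => ?_
      have hb' : (i : ℕ) + 1 ≠ b := by have := b.isLt; omega
      simp [jordanBlock, hb']

theorem jordanBlock_zero_pow_eq_zero {F : Type*} [Field F] {k l : ℕ} (h : k ≤ l) :
    jordanBlock k (0 : F) ^ l = 0 := by
  ext i j
  rw [jordanBlock_zero_pow_apply, if_neg (by have := j.isLt; omega), Matrix.zero_apply]

theorem kronecker_one_pow {F : Type*} [Field F] {m n : Type*} [Fintype m] [Fintype n]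
    [DecidableEq m] [DecidableEq n] (A : Matrix m m F) (l : ℕ) :
    (A ⊗ₖ (1 : Matrix n n F)) ^ l = (A ^ l) ⊗ₖ (1 : Matrix n n F) := by
  induction l with
  | zero => simp
  | succ l ih => rw [pow_succ, ih, ← Matrix.mul_kronecker_mul, ← pow_succ, one_mul]

theorem one_kronecker_pow {F : Type*} [Field F] {m n : Type*} [Fintype m] [Fintype n]
    [DecidableEq m] [DecidableEq n] (A : Matrix n n F) (l : ℕ) :
    ((1 : Matrix m m F) ⊗ₖ A) ^ l = (1 : Matrix m m F) ⊗ₖ (A ^ l) := by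
  induction l with
  | zero => simp
  | succ l ih => rw [pow_succ, ih, ← Matrix.mul_kronecker_mul, ← pow_succ, one_mul]

theorem commute_kronecker_one_one_kronecker {F : Type*} [Field F] {m n : Type*} [Fintype m]
    [Fintype n] [DecidableEq m] [DecidableEq n] (A : Matrix m m F) (B : Matrix n n F) :
    Commute (A ⊗ₖ (1 : Matrix n n F)) ((1 : Matrix m m F) ⊗ₖ B) := by
  simp [Commute, SemiconjBy, ← Matrix.mul_kronecker_mul]

/-- The nilpotent part `J_n(0) ⊗ I_q + I_n ⊗ J_q(0)` of a Kronecker sum of Jordan blocks. -/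
def nilpotentKroneckerSum (F : Type*) [Field F] (n q : ℕ) :
    Matrix (Fin n × Fin q) (Fin n × Fin q) F :=
  jordanBlock n 0 ⊗ₖ 1 + 1 ⊗ₖ jordanBlock q 0

theorem nilpotentKroneckerSum_pow_apply (F : Type*) [Field F] (n q k : ℕ)
    (x y : Fin n × Fin q) :
    (nilpotentKroneckerSum F n q ^ k) x y = ∑ m ∈ Finset.range (k + 1),
      (if (x.1 : ℕ) + m = y.1 then 1 else 0) * (if (x.2 : ℕ) + (k - m) = y.2 then 1 else 0) *
        (k.choose m : F) := by
  rw [nilpotentKroneckerSum, (commute_kronecker_one_one_kronecker _ _).add_pow,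
    Matrix.sum_apply]
  refine Finset.sum_congr rfl fun m _ => ?_
  rw [kronecker_one_pow, one_kronecker_pow, ← Matrix.mul_kronecker_mul, mul_one, one_mul,
    ← nsmul_eq_mul', Matrix.smul_apply, Matrix.kronecker_apply, jordanBlock_zero_pow_apply,
    jordanBlock_zero_pow_apply, nsmul_eq_mul']

theorem nilpotentKroneckerSum_pow_eq_zero {F : Type*} [Field F] (p : ℕ) [Fact p.Prime]
    [CharP F p] {e n : ℕ} (hn : n ≤ p ^ e) :
    nilpotentKroneckerSum F n (p ^ e) ^ (p ^ e) = 0 := by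
  rcases Nat.eq_zero_or_pos n with rfl | hpos
  · exact Subsingleton.elim _ _
  have : NeZero n := ⟨hpos.ne'⟩
  have : NeZero (p ^ e) := ⟨(hpos.trans_le hn).ne'⟩
  rw [nilpotentKroneckerSum,
    add_pow_char_pow_of_commute (p := p) _ (commute_kronecker_one_one_kronecker _ _),
    kronecker_one_pow, one_kronecker_pow, jordanBlock_zero_pow_eq_zero hn,
    jordanBlock_zero_pow_eq_zero le_rfl]
  simp

/-- The matrix whose columns are the Jordan chains of `J_n(0) ⊗ I_q + I_n ⊗ J_q(0)` generated by
the vectors `e_i ⊗ e_{q-1}`. -/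
def jordanChainMatrix (F : Type*) [Field F] (n q : ℕ) :
    Matrix (Fin n × Fin q) (Fin n × Fin q) F :=
  Matrix.of fun x y =>
    (nilpotentKroneckerSum F n q ^ (q - 1 - (y.2 : ℕ))) x
      (y.1, ⟨q - 1, Nat.sub_one_lt_of_lt y.2.isLt⟩)

theorem isUnit_jordanChainMatrix (F : Type*) [Field F] (n q : ℕ) :
    IsUnit (jordanChainMatrix F n q) := by
  have htri : (jordanChainMatrix F n q).BlockTriangular Prod.fst := by
    intro x y hxy
    rw [jordanChainMatrix, Matrix.of_apply, nilpotentKroneckerSum_pow_apply]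
    refine Finset.sum_eq_zero fun m _ => ?_
    have hxy' : (y.1 : ℕ) < x.1 := hxy
    rw [if_neg (show ¬ (x.1 : ℕ) + m = y.1 by omega), zero_mul, zero_mul]
  have hone : ∀ a, (jordanChainMatrix F n q).toSquareBlock Prod.fst a = 1 := by
    intro a
    ext ⟨x, rfl⟩ ⟨y, hy⟩
    have hx2 := x.2.isLt
    have hy2 := y.2.isLt
    have hxy : (⟨x, rfl⟩ : {z : Fin n × Fin q // z.1 = x.1}) = ⟨y, hy⟩ ↔
        (x.2 : ℕ) = y.2 := by
      rw [Subtype.mk.injEq, Prod.ext_iff, Fin.ext_iff (a := x.2)]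
      exact and_iff_right hy.symm
    rw [Matrix.toSquareBlock_def, Matrix.of_apply, jordanChainMatrix, Matrix.of_apply,
      nilpotentKroneckerSum_pow_apply, Finset.sum_eq_single 0, Matrix.one_apply]
    · simp only [hxy, hy, add_zero, if_true, Nat.sub_zero, Nat.choose_zero_right, Nat.cast_one,
        mul_one, one_mul]
      exact if_congr (by omega) rfl rfl
    · intro m _ hm
      simp [hy, hm]
    · simp
  rw [Matrix.isUnit_iff_isUnit_det, htri.det]
  simp [hone]

theorem nilpotentKroneckerSum_mul_jordanChainMatrix {F : Type*} [Field F] {n q : ℕ}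
    (h : nilpotentKroneckerSum F n q ^ q = 0) :
    nilpotentKroneckerSum F n q * jordanChainMatrix F n q =
      jordanChainMatrix F n q * ((1 : Matrix (Fin n) (Fin n) F) ⊗ₖ jordanBlock q 0) := by
  ext x ⟨i, j⟩
  have hj := j.isLt
  have hl : (nilpotentKroneckerSum F n q * jordanChainMatrix F n q) x (i, j) =
      (nilpotentKroneckerSum F n q ^ (q - 1 - (j : ℕ) + 1)) x
        (i, ⟨q - 1, Nat.sub_one_lt_of_lt j.isLt⟩) := by
    rw [pow_succ', Matrix.mul_apply, Matrix.mul_apply]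
    rfl
  rw [hl, Matrix.mul_apply]
  by_cases h0 : (j : ℕ) = 0
  · rw [show q - 1 - (j : ℕ) + 1 = q by omega, h, Matrix.zero_apply]
    refine (Finset.sum_eq_zero fun y _ => ?_).symm
    simp [jordanBlock, h0]
  · rw [Finset.sum_eq_single (i, ⟨(j : ℕ) - 1, by omega⟩)]
    · have h1 : (j : ℕ) - 1 + 1 = j := by omega
      have h2 : (⟨(j : ℕ) - 1, by omega⟩ : Fin q) ≠ j := by
        rw [Ne, Fin.ext_iff]
        exact fun h3 : (j : ℕ) - 1 = j => by omega
      have h3 : q - 1 - ((j : ℕ) - 1) = q - 1 - (j : ℕ) + 1 := by omega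
      simp [jordanBlock, jordanChainMatrix, h1, h2, h3]
    · rintro ⟨a, b⟩ _ hab
      rw [Matrix.kronecker_apply, Matrix.one_apply]
      by_cases ha : a = i
      · subst ha
        have hb : (b : ℕ) + 1 ≠ j := fun hb => hab (by
          rw [Prod.mk.injEq, Fin.ext_iff (a := b)]
          exact ⟨rfl, by simp only; omega⟩)
        simp [jordanBlock, hb]
      · simp [ha]
    · simp

/-- Over a field of prime characteristic `p`, for `1 ≤ n ≤ p^e` and `α, β ∈ F`, the
Kronecker sum `J_n(α) ⊗ I_{p^e} + I_n ⊗ J_{p^e}(β)` is similar over `F` to the direct sum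
of `n` copies of the Jordan block `J_{p^e}(α + β)`. -/
theorem stmt4 {F : Type*} [Field F] (p : ℕ) [Fact p.Prime] [CharP F p]
    (e n : ℕ) (hn1 : 1 ≤ n) (hn2 : n ≤ p ^ e) (α β : F) :
    ∃ P : (Matrix (Fin n × Fin (p ^ e)) (Fin n × Fin (p ^ e)) F)ˣ,
      jordanBlock n α ⊗ₖ (1 : Matrix (Fin (p ^ e)) (Fin (p ^ e)) F) +
        (1 : Matrix (Fin n) (Fin n) F) ⊗ₖ jordanBlock (p ^ e) β =
      (P : Matrix (Fin n × Fin (p ^ e)) (Fin n × Fin (p ^ e)) F) *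
        (Matrix.reindex (Equiv.prodComm (Fin (p ^ e)) (Fin n))
            (Equiv.prodComm (Fin (p ^ e)) (Fin n))
          (Matrix.blockDiagonal fun _ : Fin n => jordanBlock (p ^ e) (α + β))) *
        ((P⁻¹ : (Matrix (Fin n × Fin (p ^ e)) (Fin n × Fin (p ^ e)) F)ˣ) :
          Matrix (Fin n × Fin (p ^ e)) (Fin n × Fin (p ^ e)) F) := by
  obtain ⟨P, hP⟩ := isUnit_jordanChainMatrix F n (p ^ e)
  refine ⟨P, ?_⟩
  have hT := nilpotentKroneckerSum_mul_jordanChainMatrix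
    (nilpotentKroneckerSum_pow_eq_zero (F := F) p hn2)
  rw [← hP] at hT
  have hl : jordanBlock n α ⊗ₖ (1 : Matrix (Fin (p ^ e)) (Fin (p ^ e)) F) +
      (1 : Matrix (Fin n) (Fin n) F) ⊗ₖ jordanBlock (p ^ e) β =
        (α + β) • 1 + nilpotentKroneckerSum F n (p ^ e) := by
    rw [jordanBlock_eq_smul_one_add n α, jordanBlock_eq_smul_one_add (p ^ e) β,
      nilpotentKroneckerSum, Matrix.add_kronecker, Matrix.kronecker_add, Matrix.smul_kronecker,
      Matrix.kronecker_smul, Matrix.one_kronecker_one, add_smul]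
    abel
  rw [← Matrix.one_kronecker, jordanBlock_eq_smul_one_add (p ^ e) (α + β), hl,
    Matrix.kronecker_add, Matrix.kronecker_smul, Matrix.one_kronecker_one,
    Units.eq_mul_inv_iff_mul_eq,
    add_mul, mul_add, hT, smul_mul_assoc, mul_smul_comm, one_mul, mul_one]
end

section
/- Let F be a field of prime characteristic p containing a subfield E with p^n elements, n ≥ 1, let e ≥ 0, a ∈ F, and suppose h(X) = X^{p^{n+e}} − X^{p^e} − a is irreducible in F[X]. Let A ∈ M_m(F), m = p^{n+e}, be the companion matrix of h. Then q(X) = X^{p^n} − X − a is irreducible in F[X], and the set of eigenvalues of ad A is exactly the subfield E of F with p^n elements. -/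
open Polynomial

/-- The companion matrix is the matrix of multiplication by the adjoined root. -/
theorem companionMatrix_eq_leftMulMatrix {F : Type*} [Field F] (m : ℕ) (g : F[X])
    (hg : g.Monic) (hm : g.natDegree = m) :
    ∃ B : Module.Basis (Fin m) F (AdjoinRoot g),
      companionMatrix m g = Algebra.leftMulMatrix B (AdjoinRoot.root g) := by
  subst hm
  refine ⟨(AdjoinRoot.powerBasis hg.ne_zero).basis, ?_⟩
  have h := (AdjoinRoot.powerBasis hg.ne_zero).leftMulMatrix
  rw [PowerBasis.minpolyGen_eq, AdjoinRoot.minpoly_powerBasis_gen_of_monic hg] at h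
  rw [AdjoinRoot.powerBasis_gen] at h
  refine Eq.trans ?_ h.symm
  ext i j
  have hi : (i : ℕ) < g.natDegree := i.2
  have hj : (j : ℕ) < g.natDegree := j.2
  change (if (i : ℕ) = (j : ℕ) + 1 then 1
      else if (j : ℕ) = g.natDegree - 1 then -g.coeff i else 0) =
    if (j : ℕ) + 1 = g.natDegree then -g.coeff i else if (i : ℕ) = (j : ℕ) + 1 then 1 else 0
  split_ifs <;> first | rfl | omega

/-- The subfield with `q` elements consists of the roots of `X ^ q - X`. -/
theorem Subfield.mem_iff_pow_natCard_eq {F : Type*} [Field F] (E : Subfield F) [Finite E] (b : F) :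
    b ∈ E ↔ b ^ Nat.card E = b := by
  classical
  have := Fintype.ofFinite E
  have hcard : 1 < Nat.card E := Finite.one_lt_card
  have hne : (X ^ Nat.card E - X : F[X]) ≠ 0 := FiniteField.X_pow_card_sub_X_ne_zero F hcard
  have hmem : ∀ x ∈ E, x ^ Nat.card E = x := fun x hx => by
    rw [Nat.card_eq_fintype_card]
    exact congrArg Subtype.val (FiniteField.pow_card (⟨x, hx⟩ : E))
  refine ⟨hmem b, fun hb => ?_⟩
  have hsub : (Finset.univ.map (Function.Embedding.subtype (· ∈ E))) ⊆
      (X ^ Nat.card E - X : F[X]).roots.toFinset := by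
    intro x hx
    obtain ⟨y, -, rfl⟩ := Finset.mem_map.1 hx
    rw [Multiset.mem_toFinset, mem_roots hne]
    simpa [IsRoot, sub_eq_zero] using hmem y y.2
  have heq := Finset.eq_of_subset_of_card_le hsub <| by
    rw [Finset.card_map, Finset.card_univ, ← Nat.card_eq_fintype_card]
    refine (Multiset.toFinset_card_le _).trans ((card_roots' _).trans ?_)
    rw [FiniteField.X_pow_card_sub_X_natDegree_eq F hcard]
  have hb' : b ∈ (X ^ Nat.card E - X : F[X]).roots.toFinset := by
    rw [Multiset.mem_toFinset, mem_roots hne]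
    simpa [IsRoot, sub_eq_zero] using hb
  rw [← heq] at hb'
  obtain ⟨y, -, rfl⟩ := Finset.mem_map.1 hb'
  exact y.2

/-- If `X₀` intertwines `x` with its translate `x - b`, where `x` is a root of
`X ^ p ^ (n + e) - X ^ p ^ e - a`, then `X₀` is annihilated by `(b ^ p ^ n - b) ^ p ^ e`. -/
theorem smul_eq_zero_of_mul_sub_mul_eq_smul {F R : Type*} [Field F] [Ring R] [Algebra F R]
    (p : ℕ) [Fact p.Prime] [CharP F p] (n e : ℕ) {a b : F} {x X₀ : R}
    (hx : aeval x (X ^ p ^ (n + e) - X ^ p ^ e - C a : F[X]) = 0)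
    (h : x * X₀ - X₀ * x = b • X₀) : (b ^ p ^ n - b) ^ p ^ e • X₀ = 0 := by
  have hs : SemiconjBy X₀ x (x - algebraMap F R b) := by
    rw [SemiconjBy, sub_mul, ← Algebra.smul_def, ← h, sub_sub_cancel]
  have hpow (k : ℕ) :
      X₀ * x ^ p ^ k = x ^ p ^ k * X₀ - b ^ p ^ k • X₀ := by
    have h1 : (x - algebraMap F R b) ^ p ^ k = x ^ p ^ k - algebraMap F R (b ^ p ^ k) := by
      have := congrArg (aeval x) (sub_pow_char_pow (p := p) (n := k) (X : F[X]) (C b))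
      simpa using this
    rw [(hs.pow_right (p ^ k)).eq, h1, sub_mul, Algebra.smul_def]
  simp only [map_sub, map_pow, aeval_X, aeval_C] at hx
  have h1 : X₀ * (x ^ p ^ (n + e) - x ^ p ^ e - algebraMap F R a) = 0 := by rw [hx, mul_zero]
  have h2 : (x ^ p ^ (n + e) - x ^ p ^ e - algebraMap F R a) * X₀ = 0 := by rw [hx, zero_mul]
  rw [mul_sub, mul_sub, hpow, hpow, ← Algebra.commutes] at h1
  rw [sub_mul, sub_mul] at h2
  rw [sub_pow_char_pow, ← pow_mul, ← pow_add, sub_smul]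
  rw [← sub_eq_zero.2 (h2.trans h1.symm)]
  abel

/-- An algebra endomorphism moving `x` to `x - b` intertwines multiplication by `x`
with multiplication by `x - b`. -/
theorem leftMulMatrix_mul_toMatrix_sub {F K ι : Type*} [Field F] [CommRing K] [Algebra F K]
    [Fintype ι] [DecidableEq ι] (B : Module.Basis ι F K) (σ : K →ₐ[F] K) {x : K} {b : F}
    (h : σ x = x - algebraMap F K b) :
    Algebra.leftMulMatrix B x * LinearMap.toMatrix B B σ.toLinearMap -
      LinearMap.toMatrix B B σ.toLinearMap * Algebra.leftMulMatrix B x =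
      b • LinearMap.toMatrix B B σ.toLinearMap := by
  rw [Algebra.leftMulMatrix_apply, ← LinearMap.toMatrix_mul, ← LinearMap.toMatrix_mul,
    ← map_sub, ← map_smul]
  congr 1
  ext y
  simp [h, sub_mul, Algebra.smul_def]

/-- Let `F` have prime characteristic `p` and contain a subfield `E` with `p^n` elements,
`n ≥ 1`, and suppose `h(X) = X^{p^{n+e}} - X^{p^e} - a` is irreducible over `F`.  Let `A` be
the companion matrix of `h`.  Then `q(X) = X^{p^n} - X - a` is irreducible in `F[X]`, and
the set of eigenvalues of `ad A` is exactly the subfield `E`. -/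
theorem stmt8 {F : Type*} [Field F] (p : ℕ) [Fact p.Prime] [CharP F p]
    (n e : ℕ) (hn : 1 ≤ n) (E : Subfield F) (hE : Nat.card E = p ^ n) (a : F)
    (hirr : Irreducible (X ^ p ^ (n + e) - X ^ p ^ e - C a : Polynomial F))
    (A : Matrix (Fin (p ^ (n + e))) (Fin (p ^ (n + e))) F)
    (hA : A = companionMatrix (p ^ (n + e)) (X ^ p ^ (n + e) - X ^ p ^ e - C a)) :
    Irreducible (X ^ p ^ n - X - C a : Polynomial F) ∧
    {b : F | ∃ X0 : Matrix (Fin (p ^ (n + e))) (Fin (p ^ (n + e))) F,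
      X0 ≠ 0 ∧ A * X0 - X0 * A = b • X0} = (E : Set F) := by
  have hp : 1 < p := (Fact.out : p.Prime).one_lt
  have hlt : p ^ e < p ^ (n + e) := Nat.pow_lt_pow_right hp (by omega)
  set h : F[X] := X ^ p ^ (n + e) - X ^ p ^ e - C a with hh
  have hdeg : (X ^ p ^ e + C a : F[X]).degree < (p ^ (n + e) : ℕ) := by
    rw [degree_X_pow_add_C (by positivity)]
    exact_mod_cast hlt
  have hsub : h = X ^ p ^ (n + e) - (X ^ p ^ e + C a) := by rw [hh, sub_sub]
  have hmonic : h.Monic := hsub ▸ monic_X_pow_sub hdeg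
  have hnat : h.natDegree = p ^ (n + e) := by
    rw [hsub]
    refine natDegree_eq_of_degree_eq_some ?_
    rw [degree_sub_eq_left_of_degree_lt (by rwa [degree_X_pow]), degree_X_pow]
  have : Finite E := Nat.finite_of_card_ne_zero (by rw [hE]; positivity)
  obtain ⟨B, hB⟩ := companionMatrix_eq_leftMulMatrix _ h hmonic hnat
  rw [hB] at hA
  refine ⟨of_irreducible_expand (p := p ^ e) (by positivity) ?_, ?_⟩
  · simpa [← pow_mul, ← pow_add, hh, add_comm e] using hirr
  ext b
  rw [SetLike.mem_coe, E.mem_iff_pow_natCard_eq, hE, Set.mem_ofPred_eq]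
  constructor
  · rintro ⟨X₀, hX₀, hAX⟩
    have hroot : aeval A h = 0 := by
      rw [hA, aeval_algHom_apply, AdjoinRoot.aeval_eq, AdjoinRoot.mk_self, map_zero]
    have := smul_eq_zero_of_mul_sub_mul_eq_smul p n e hroot hAX
    exact sub_eq_zero.1 (eq_zero_of_pow_eq_zero ((smul_eq_zero.1 this).resolve_right hX₀))
  · intro hb
    have hbe : b ^ p ^ (n + e) = b ^ p ^ e := by rw [pow_add, pow_mul, hb]
    have hcomp : h.comp (X - C b) = h := by
      simp only [hh, sub_comp, X_pow_comp, C_comp, sub_pow_char_pow, ← C_pow, hbe]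
      ring
    have hroot : aeval (AdjoinRoot.root h - algebraMap F (AdjoinRoot h) b) h = 0 := by
      have := congrArg (aeval (AdjoinRoot.root h)) hcomp
      rw [aeval_comp, AdjoinRoot.aeval_eq h, AdjoinRoot.mk_self] at this
      simpa using this
    let σ : AdjoinRoot h →ₐ[F] AdjoinRoot h := AdjoinRoot.liftAlgHom h (Algebra.ofId F _) _ hroot
    have : Fact (Irreducible h) := ⟨hirr⟩
    refine ⟨LinearMap.toMatrix B B σ.toLinearMap, fun h0 => ?_, ?_⟩
    · have h1 := (LinearEquiv.map_eq_zero_iff _).1 h0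
      have h2 : σ 1 = 0 := LinearMap.congr_fun h1 1
      exact one_ne_zero ((map_one σ).symm.trans h2)
    · rw [hA]
      exact leftMulMatrix_mul_toMatrix_sub B σ (AdjoinRoot.liftAlgHom_root _ _ _ hroot)
end

section
/- Let F be a field of prime characteristic p containing a subfield with p^n elements, n ≥ 1, let e ≥ 0, a ∈ F, and suppose h(X) = X^{p^{n+e}} − X^{p^e} − a is irreducible in F[X]. Let A ∈ M_m(F), m = p^{n+e}, be the companion matrix of h. Then every eigenvector of ad A (for any eigenvalue b ∈ F) is an invertible matrix, and every eigenspace of ad A has F-dimension p^{n+e}. -/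
open Polynomial

open Matrix

theorem companionMatrix_mulVec_single_of_succ_lt {F : Type*} [Field F] {m : ℕ} (g : F[X]) {k : ℕ}
    (hk : k + 1 < m) :
    companionMatrix m g *ᵥ Pi.single ⟨k, by omega⟩ 1 = Pi.single ⟨k + 1, hk⟩ 1 := by
  ext i
  have h : k ≠ m - 1 := by omega
  simp [companionMatrix, Pi.single_apply, Fin.ext_iff, h]

theorem companionMatrix_pow_mulVec_single_zero {F : Type*} [Field F] {m : ℕ} (g : F[X]) {k : ℕ}
    (hk : k < m) :
    companionMatrix m g ^ k *ᵥ Pi.single ⟨0, by omega⟩ 1 = Pi.single ⟨k, hk⟩ 1 := by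
  induction k with
  | zero => simp only [pow_zero, one_mulVec]
  | succ k ih =>
    rw [pow_succ', ← mulVec_mulVec, ih (by omega), companionMatrix_mulVec_single_of_succ_lt g hk]

theorem aeval_companionMatrix {F : Type*} [Field F] {m : ℕ} (hm : 0 < m) {g : F[X]}
    (hg : g.Monic) (hdeg : g.natDegree = m) : aeval (companionMatrix m g) g = 0 := by
  set A := companionMatrix m g with hA
  have h0 : aeval A g *ᵥ Pi.single ⟨0, hm⟩ 1 = 0 := by
    have hlast : A ^ m *ᵥ Pi.single ⟨0, hm⟩ 1 = fun i : Fin m => -g.coeff i := by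
      obtain ⟨k, rfl⟩ : ∃ k, m = k + 1 := ⟨m - 1, by omega⟩
      rw [pow_succ', ← mulVec_mulVec, companionMatrix_pow_mulVec_single_zero g k.lt_succ_self]
      ext i
      have h : (i : ℕ) ≠ k + 1 := by omega
      simp [hA, companionMatrix, h]
    have hc : g.coeff m = 1 := hdeg ▸ hg.coeff_natDegree
    rw [aeval_eq_sum_range, hdeg, Finset.sum_range_succ, add_mulVec, hc, one_smul, hlast,
      Finset.sum_range, sum_mulVec]
    simp_rw [smul_mulVec, hA, companionMatrix_pow_mulVec_single_zero g (Fin.is_lt _)]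
    ext i
    simp [Finset.sum_apply, Pi.single_apply]
  refine ext_of_mulVec_single fun k => ?_
  rw [← companionMatrix_pow_mulVec_single_zero g k.is_lt, ← hA, mulVec_mulVec,
    ← aeval_X_pow (R := F) A, ← map_mul, mul_comm, map_mul, ← mulVec_mulVec, h0]
  simp

/-- A nonzero vector is cyclic for a matrix annihilated by an irreducible polynomial of full
degree. -/
theorem exists_aeval_mulVec_eq {F : Type*} [Field F] {m : ℕ} {A : Matrix (Fin m) (Fin m) F}
    {g : F[X]} (hirr : Irreducible g) (hdeg : g.natDegree = m) (hA : aeval A g = 0)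
    {v : Fin m → F} (hv : v ≠ 0) (w : Fin m → F) : ∃ q : F[X], aeval A q *ᵥ v = w := by
  let φ : F[X] →ₗ[F] (Fin m → F) :=
    (LinearMap.applyₗ v).comp ((toLin' : _ ≃ₗ[F] _).toLinearMap.comp (aeval A).toLinearMap)
  have hφ (q : F[X]) : φ q = aeval A q *ᵥ v := by simp [φ]
  let ψ := (φ.domRestrict (degreeLT F m)).comp (degreeLTEquiv F m).symm.toLinearMap
  have hinj : Function.Injective ψ := by
    refine Function.Injective.comp (g := φ.domRestrict (degreeLT F m)) ?_
      (degreeLTEquiv F m).symm.injective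
    rw [← LinearMap.ker_eq_bot, LinearMap.ker_eq_bot']
    rintro ⟨q, hq⟩ h
    rw [LinearMap.domRestrict_apply, hφ] at h
    ext1
    by_contra hq0
    have hndvd : ¬ g ∣ q := fun h' => by
      have := degree_le_of_dvd h' hq0
      rw [degree_eq_natDegree hirr.ne_zero, hdeg] at this
      exact absurd (mem_degreeLT.1 hq) this.not_gt
    obtain ⟨u, t, hut⟩ := (hirr.coprime_iff_not_dvd.2 hndvd)
    apply hv
    have := congrArg (fun r => aeval A r *ᵥ v) hut
    simpa [hA, add_mulVec, ← mulVec_mulVec, h] using this.symm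
  obtain ⟨c, hc⟩ := LinearMap.surjective_of_injective hinj w
  exact ⟨_, (hφ _).symm.trans hc⟩

theorem mul_aeval_of_mul_sub_mul_eq_smul {F R : Type*} [Field F] [Ring R] [Algebra F R]
    {A Y : R} {b : F} (h : A * Y - Y * A = b • Y) (q : F[X]) :
    Y * aeval A q = aeval (A - algebraMap F R b) q * Y := by
  have hY : Y * A = (A - algebraMap F R b) * Y := by
    rw [sub_mul, ← Algebra.smul_def, ← h, sub_sub_cancel]
  induction q using Polynomial.induction_on with
  | C c => simp [Algebra.commutes]
  | add q r hq hr => simp [mul_add, add_mul, hq, hr]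
  | monomial k c ih =>
    rw [pow_succ, ← mul_assoc, map_mul _ _ X, map_mul _ _ X, ← mul_assoc, ih, aeval_X, aeval_X, mul_assoc, hY,
      mul_assoc]

theorem eq_zero_of_mulVec_eq_zero {F : Type*} [Field F] {m : ℕ} {A : Matrix (Fin m) (Fin m) F}
    {g : F[X]} (hirr : Irreducible g) (hdeg : g.natDegree = m) (hA : aeval A g = 0)
    {Y : Matrix (Fin m) (Fin m) F} {b : F} (h : A * Y - Y * A = b • Y)
    {v : Fin m → F} (hv : v ≠ 0) (hYv : Y *ᵥ v = 0) : Y = 0 := by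
  refine ext_of_mulVec_single fun k => ?_
  obtain ⟨q, hq⟩ := exists_aeval_mulVec_eq hirr hdeg hA hv (Pi.single k 1)
  rw [← hq, mulVec_mulVec, mul_aeval_of_mul_sub_mul_eq_smul h, ← mulVec_mulVec, hYv]
  simp

theorem isUnit_of_mul_sub_mul_eq_smul {F : Type*} [Field F] {m : ℕ}
    {A : Matrix (Fin m) (Fin m) F}
    {g : F[X]} (hirr : Irreducible g) (hdeg : g.natDegree = m) (hA : aeval A g = 0)
    {Y : Matrix (Fin m) (Fin m) F} {b : F} (h : A * Y - Y * A = b • Y) (hY : Y ≠ 0) :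
    IsUnit Y := by
  rw [isUnit_iff_isUnit_det, isUnit_iff_ne_zero]
  intro hdet
  obtain ⟨v, hv, hYv⟩ := exists_mulVec_eq_zero_iff.2 hdet
  exact hY (eq_zero_of_mulVec_eq_zero hirr hdeg hA h hv hYv)

theorem mem_ker_adMat_sub_smul_iff {F : Type*} [Field F] {m : ℕ}
    {A Y : Matrix (Fin m) (Fin m) F} {b : F} :
    Y ∈ LinearMap.ker (adMat A - b • LinearMap.id) ↔ A * Y - Y * A = b • Y := by
  rw [LinearMap.mem_ker, LinearMap.sub_apply, sub_eq_zero]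
  rfl

/-- Evaluation at a nonzero vector identifies a nonzero eigenspace of `ad A` with `F ^ m`. -/
theorem finrank_ker_adMat_sub_smul {F : Type*} [Field F] {m : ℕ} (hm : 0 < m)
    {A : Matrix (Fin m) (Fin m) F}
    {g : F[X]} (hirr : Irreducible g) (hdeg : g.natDegree = m) (hA : aeval A g = 0)
    {Y : Matrix (Fin m) (Fin m) F} {b : F} (h : A * Y - Y * A = b • Y) (hY : Y ≠ 0) :
    Module.finrank F (LinearMap.ker (adMat A - b • LinearMap.id)) = m := by
  let v : Fin m → F := Pi.single ⟨0, hm⟩ 1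
  have hv : v ≠ 0 := by simp [v]
  let ev : Matrix (Fin m) (Fin m) F →ₗ[F] (Fin m → F) :=
    (LinearMap.applyₗ v).comp (toLin' : _ ≃ₗ[F] _).toLinearMap
  have hev (Z : Matrix (Fin m) (Fin m) F) : ev Z = Z *ᵥ v := by simp [ev]
  let φ := ev.domRestrict (LinearMap.ker (adMat A - b • LinearMap.id))
  have hinj : Function.Injective φ := by
    rw [← LinearMap.ker_eq_bot, LinearMap.ker_eq_bot']
    rintro ⟨Z, hZ⟩ hZv
    ext1
    exact eq_zero_of_mulVec_eq_zero hirr hdeg hA (mem_ker_adMat_sub_smul_iff.1 hZ) hv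
      ((hev Z).symm.trans hZv)
  have hsurj : Function.Surjective φ := by
    intro w
    have hu := (isUnit_iff_isUnit_det _).1 (isUnit_of_mul_sub_mul_eq_smul hirr hdeg hA h hY)
    obtain ⟨q, hq⟩ := exists_aeval_mulVec_eq hirr hdeg hA hv (Y⁻¹ *ᵥ w)
    refine ⟨⟨Y * aeval A q, mem_ker_adMat_sub_smul_iff.2 ?_⟩, (hev _).trans ?_⟩
    · have hcomm : aeval A q * A = A * aeval A q := by
        simpa using congrArg (aeval A) (mul_comm q X)
      rw [mul_assoc, hcomm, ← mul_assoc, ← mul_assoc, ← sub_mul, h, smul_mul_assoc]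
    · rw [Submodule.subtype_apply, ← mulVec_mulVec, hq, mulVec_mulVec, mul_nonsing_inv _ hu, one_mulVec]
  rw [(LinearEquiv.ofBijective φ ⟨hinj, hsurj⟩).finrank_eq, Module.finrank_fin_fun]

/-- Let `F` have prime characteristic `p` and contain a subfield with `p^n` elements,
`n ≥ 1`, and suppose `h(X) = X^{p^{n+e}} - X^{p^e} - a` is irreducible over `F`.  Let `A` be
the companion matrix of `h`.  Then every eigenvector of `ad A` (for any eigenvalue `b ∈ F`)
is an invertible matrix, and every eigenspace of `ad A` has `F`-dimension `p^{n+e}`. -/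
theorem stmt9 {F : Type*} [Field F] (p : ℕ) [Fact p.Prime] [CharP F p]
    (n e : ℕ) (hn : 1 ≤ n) (hE : ∃ E : Subfield F, Nat.card E = p ^ n) (a : F)
    (hirr : Irreducible (X ^ p ^ (n + e) - X ^ p ^ e - C a : Polynomial F))
    (A : Matrix (Fin (p ^ (n + e))) (Fin (p ^ (n + e))) F)
    (hA : A = companionMatrix (p ^ (n + e)) (X ^ p ^ (n + e) - X ^ p ^ e - C a)) :
    (∀ (b : F) (X0 : Matrix (Fin (p ^ (n + e))) (Fin (p ^ (n + e))) F),
      A * X0 - X0 * A = b • X0 → X0 ≠ 0 → IsUnit X0) ∧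
    (∀ b : F,
      (∃ X0 : Matrix (Fin (p ^ (n + e))) (Fin (p ^ (n + e))) F,
        X0 ≠ 0 ∧ A * X0 - X0 * A = b • X0) →
      Module.finrank F (LinearMap.ker (adMat A - b • LinearMap.id)) = p ^ (n + e)) := by
  have hlt : p ^ e < p ^ (n + e) :=
    Nat.pow_lt_pow_right (Fact.out : p.Prime).one_lt (by omega)
  have hm : 0 < p ^ (n + e) := by omega
  set g : F[X] := X ^ p ^ (n + e) - X ^ p ^ e - C a with hg
  have hlow : (X ^ p ^ e + C a : F[X]).degree < (p ^ (n + e) : ℕ) := by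
    refine (degree_add_le _ _).trans_lt (max_lt ?_ ?_)
    · rw [degree_X_pow]
      exact_mod_cast hlt
    · exact degree_C_le.trans_lt (by exact_mod_cast hm)
  have hg' : g = X ^ p ^ (n + e) - (X ^ p ^ e + C a) := by rw [hg, sub_sub]
  have hmonic : g.Monic := hg' ▸ monic_X_pow_sub hlow
  have hdeg : g.natDegree = p ^ (n + e) := by
    rw [hg']
    refine natDegree_eq_of_degree_eq_some ?_
    rw [degree_sub_eq_left_of_degree_lt (by rwa [degree_X_pow]), degree_X_pow]
  have hA0 : aeval A g = 0 := hA ▸ aeval_companionMatrix hm hmonic hdeg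
  exact ⟨fun b Y h hY => isUnit_of_mul_sub_mul_eq_smul hirr hdeg hA0 h hY,
    fun b ⟨Y, hY, h⟩ => finrank_ker_adMat_sub_smul hm hirr hdeg hA0 h hY⟩
end

section
/- Let F be a field of prime characteristic p containing a subfield with p^n elements, n ≥ 1, and let a ∈ F. Then there exists an integer m with 0 ≤ m ≤ n such that every irreducible factor of q(X) = X^{p^n} − X − a in F[X] has degree p^m. -/
open Polynomial

/-- If all irreducible factors of a nonzero polynomial have degree `d`, then `d` divides its
degree. -/
theorem Polynomial.dvd_natDegree_of_forall_irreducible {F : Type*} [Field F] {d : ℕ} {f : F[X]}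
    (hf : f ≠ 0) (h : ∀ g : F[X], Irreducible g → g ∣ f → g.natDegree = d) :
    d ∣ f.natDegree := by
  induction f using WfDvdMonoid.induction_on_irreducible with
  | zero => exact absurd rfl hf
  | unit u hu => simp [natDegree_eq_zero_of_isUnit hu]
  | mul b i hb hi ih =>
    rw [natDegree_mul hi.ne_zero hb, h i hi (dvd_mul_right i b)]
    exact (dvd_refl d).add (ih hb fun g hg hgb => h g hg (hgb.mul_left i))

/-- The fixed points of `x ↦ x ^ |E|` in an extension of a finite field `E` lie in `E`. -/
theorem FiniteField.mem_range_algebraMap_of_pow_card_eq {E K : Type*} [Field E] [Finite E]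
    [Field K] [Algebra E K] {c : K} (hc : c ^ Nat.card E = c) : c ∈ (algebraMap E K).range := by
  have := Fintype.ofFinite E
  rw [Nat.card_eq_fintype_card] at hc
  have hne := FiniteField.X_pow_card_sub_X_ne_zero E (Fintype.one_lt_card (α := E))
  refine Splits.mem_range_of_isRoot (f := (X ^ Fintype.card E - X : E[X])) ?_ hne ?_
  · rw [splits_iff_card_roots, FiniteField.roots_X_pow_card_sub_X,
      FiniteField.X_pow_card_sub_X_natDegree_eq E Fintype.one_lt_card]
    rfl
  · simp [hc]

/-- All irreducible factors of a generalized Artin-Schreier polynomial have the same degree. -/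
theorem natDegree_eq_of_irreducible_of_dvd_X_pow_sub_X_sub_C {F : Type*} [Field F] (p : ℕ)
    [Fact p.Prime] [CharP F p] {n : ℕ} (E : Subfield F) (hE : Nat.card E = p ^ n) {a : F}
    {g h : F[X]} (hg : Irreducible g) (hgq : g ∣ X ^ p ^ n - X - C a)
    (hh : Irreducible h) (hhq : h ∣ X ^ p ^ n - X - C a) : g.natDegree = h.natDegree := by
  let K := AlgebraicClosure F
  have : CharP K p := charP_of_injective_algebraMap (algebraMap F K).injective p
  have : Finite E := Nat.finite_of_card_ne_zero (hE ▸ pow_ne_zero n (Fact.out : p.Prime).ne_zero)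
  obtain ⟨α, hα⟩ := IsAlgClosed.exists_aeval_eq_zero K g hg.degree_pos.ne'
  obtain ⟨β, hβ⟩ := IsAlgClosed.exists_aeval_eq_zero K h hh.degree_pos.ne'
  have hα' := aeval_eq_zero_of_dvd_aeval_eq_zero hgq hα
  have hβ' := aeval_eq_zero_of_dvd_aeval_eq_zero hhq hβ
  simp only [map_sub, map_pow, aeval_X, aeval_C] at hα' hβ'
  obtain ⟨c, hc⟩ : β - α ∈ (algebraMap E K).range := by
    apply FiniteField.mem_range_algebraMap_of_pow_card_eq
    rw [hE, sub_pow_char_pow]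
    linear_combination hβ' - hα'
  have hβα : β = α + algebraMap F K c := by
    rw [← sub_eq_iff_eq_add', ← hc]
    rfl
  have key : ∀ {f : F[X]} {x : K}, Irreducible f → aeval x f = 0 →
      f.natDegree = (minpoly F x).natDegree := fun hf hx => by
    rw [← minpoly.eq_of_irreducible hf hx,
      natDegree_mul_C (inv_ne_zero (leadingCoeff_ne_zero.mpr hf.ne_zero))]
  rw [key hg hα, key hh hβ, hβα, minpoly.add_algebraMap, natDegree_comp]
  simp

/-- Let `F` have prime characteristic `p` and contain a subfield with `p^n` elements,
`n ≥ 1`, and let `a ∈ F`.  Then there is an integer `m` with `0 ≤ m ≤ n` such that every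
irreducible factor of the generalized Artin-Schreier polynomial `X^{p^n} - X - a` in `F[X]`
has degree `p^m`. -/
theorem stmt12 {F : Type*} [Field F] (p : ℕ) [Fact p.Prime] [CharP F p]
    (n : ℕ) (hn : 1 ≤ n) (hE : ∃ E : Subfield F, Nat.card E = p ^ n) (a : F) :
    ∃ m : ℕ, m ≤ n ∧
      ∀ g : Polynomial F, Irreducible g → g ∣ (X ^ p ^ n - X - C a) →
        g.natDegree = p ^ m := by
  obtain ⟨E, hE⟩ := hE
  have hp : p.Prime := Fact.out
  have hlt : 1 < p ^ n := Nat.one_lt_pow (by omega) hp.one_lt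
  have hdeg : (X ^ p ^ n - X - C a : F[X]).natDegree = p ^ n := by
    rw [natDegree_sub_C, FiniteField.X_pow_card_sub_X_natDegree_eq F hlt]
  have hne : (X ^ p ^ n - X - C a : F[X]) ≠ 0 := ne_zero_of_natDegree_gt (n := 0) (by omega)
  obtain ⟨g, hg, hgq⟩ := WfDvdMonoid.exists_irreducible_factor
    (not_isUnit_of_natDegree_pos (X ^ p ^ n - X - C a : F[X]) (by omega)) hne
  have hall : ∀ h : F[X], Irreducible h → h ∣ X ^ p ^ n - X - C a → h.natDegree = g.natDegree :=
    fun h hh hhq => natDegree_eq_of_irreducible_of_dvd_X_pow_sub_X_sub_C p E hE hh hhq hg hgq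
  have hdvd := dvd_natDegree_of_forall_irreducible hne hall
  rw [hdeg] at hdvd
  obtain ⟨m, hm, hgm⟩ := (Nat.dvd_prime_pow hp).mp hdvd
  exact ⟨m, hm, fun h hh hhq => (hall h hh hhq).trans hgm⟩
end

section
/- Let F be a field of prime characteristic p containing a subfield with p^n elements, n ≥ 1, and let a ∈ F. Suppose F is algebraic over its subfield with p^n elements (equivalently, F is algebraic over its prime field) and that q(X) = X^{p^n} − X − a has no root in F. Then every irreducible factor of q in F[X] has degree exactly p. -/
open Polynomial

/-- In a field algebraic over its prime field, a finite set of
elements lies in a finite subfield. -/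
theorem exists_finite_subfield_of_finite {F : Type*} [Field F] (p : ℕ) [Fact p.Prime] [CharP F p]
    (halg : ∀ x : F, ∃ k : ℕ, 1 ≤ k ∧ x ^ p ^ k = x) {S : Set F} (hS : S.Finite) :
    ∃ K : Subfield F, Finite K ∧ S ⊆ K := by
  let := ZMod.algebra F p
  have : Finite S := hS
  have : FiniteDimensional (ZMod p) (IntermediateField.adjoin (ZMod p) S) := by
    refine IntermediateField.finiteDimensional_adjoin fun x _ ↦ ?_
    obtain ⟨k, hk, hx⟩ := halg x
    have hp : 1 < p := (Fact.out : p.Prime).one_lt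
    refine ⟨X ^ p ^ k - X, monic_X_pow_sub ?_, by simp [hx]⟩
    rw [degree_X]
    exact_mod_cast Nat.one_lt_pow (by omega) hp
  have : Finite (IntermediateField.adjoin (ZMod p) S) := Module.finite_of_finite (ZMod p)
  exact ⟨(IntermediateField.adjoin (ZMod p) S).toSubfield, this,
    IntermediateField.subset_adjoin _ _⟩

/-- The order of a finite field is a power of the order of each of its subfields. -/
theorem Subfield.exists_natCard_eq_pow {F : Type*} [Field F] {E K : Subfield F} [Finite K]
    (h : E ≤ K) : ∃ m : ℕ, Nat.card K = Nat.card E ^ m := by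
  let := (Subfield.inclusion h).toAlgebra
  have : Finite E := Finite.of_injective _ (Subfield.inclusion h).injective
  exact ⟨_, Module.natCard_eq_pow_finrank (K := E) (V := K)⟩

theorem FiniteField.mem_range_of_pow_natCard_eq {K L : Type*} [Field K] [Finite K] [Field L]
    (f : K →+* L) {x : L} (hx : x ^ Nat.card K = x) : x ∈ f.range := by
  have := Fintype.ofFinite K
  rw [Nat.card_eq_fintype_card] at hx
  have hsplit : (X ^ Fintype.card K - X : K[X]).Splits := by
    rw [splits_iff_card_roots, FiniteField.roots_X_pow_card_sub_X,
      FiniteField.X_pow_card_sub_X_natDegree_eq K Fintype.one_lt_card]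
    rfl
  refine hsplit.mem_range_of_isRoot
    (FiniteField.X_pow_card_sub_X_ne_zero K Fintype.one_lt_card) ?_
  simp [hx]

/-- The iterates of a `p ^ n`-power Frobenius that translates `α` by `a`. -/
theorem pow_pow_eq_add_sum {L : Type*} [CommRing L] (p n : ℕ) [ExpChar L p] {α a : L}
    (h : α ^ p ^ n = α + a) (m : ℕ) :
    α ^ (p ^ n) ^ m = α + ∑ i ∈ Finset.range m, a ^ (p ^ n) ^ i := by
  induction m with
  | zero => simp
  | succ m ih =>
    rw [pow_succ', pow_mul, h, ← pow_mul, add_pow_expChar_pow, pow_mul, ih, Finset.sum_range_succ,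
      add_assoc]

theorem eval₂_pow_eq_zero {F L : Type*} [Field F] [Field L] (p r : ℕ) [ExpChar L p]
    (f : F →+* L) {g : F[X]} (hg : ∀ i, g.coeff i ^ p ^ r = g.coeff i) {x : L}
    (hx : g.eval₂ f x = 0) : g.eval₂ f (x ^ p ^ r) = 0 := by
  have h := congrArg (iterateFrobenius L p r) hx
  rw [hom_eval₂, map_zero] at h
  rw [← h, eval₂_eq_sum_range, eval₂_eq_sum_range]
  refine Finset.sum_congr rfl fun i _ ↦ ?_
  simp [iterateFrobenius_def, ← map_pow, hg]

/-- Let `F` have prime characteristic `p` and contain a subfield with `p^n` elements,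
`n ≥ 1`.  Suppose `F` is algebraic over its prime field (equivalently, every element of `F`
lies in a finite subfield, i.e. satisfies `x^{p^k} = x` for some `k ≥ 1`), and suppose
`q(X) = X^{p^n} - X - a` has no root in `F`.  Then every irreducible factor of `q` in `F[X]`
has degree exactly `p`. -/
theorem stmt13 {F : Type*} [Field F] (p : ℕ) [Fact p.Prime] [CharP F p]
    (n : ℕ) (hn : 1 ≤ n) (hE : ∃ E : Subfield F, Nat.card E = p ^ n) (a : F)
    (halg : ∀ x : F, ∃ k : ℕ, 1 ≤ k ∧ x ^ p ^ k = x)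
    (hnoroot : ∀ x : F, x ^ p ^ n - x ≠ a) :
    ∀ g : Polynomial F, Irreducible g → g ∣ (X ^ p ^ n - X - C a) →
      g.natDegree = p := by
  intro g hg hdvd
  have hp : p.Prime := Fact.out
  obtain ⟨E, hE⟩ := hE
  have hEfin : Finite E := Nat.finite_of_card_ne_zero (hE ▸ pow_ne_zero n hp.ne_zero)
  obtain ⟨K, hKfin, hK⟩ := exists_finite_subfield_of_finite p halg
    (S := E ∪ {a} ∪ g.coeffs) (((Set.toFinite _).union (Set.finite_singleton a)).union
      g.coeffs.finite_toSet)
  obtain ⟨m, hm⟩ := Subfield.exists_natCard_eq_pow (E := E) (K := K)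
    fun x hx ↦ hK (.inl (.inl hx))
  rw [hE] at hm
  have haK : a ∈ K := hK (.inl (.inr rfl))
  have hpow : ∀ x ∈ K, x ^ (p ^ n) ^ m = x := fun x hx ↦ by
    have := Fintype.ofFinite K
    have h := FiniteField.pow_card (⟨x, hx⟩ : K)
    rw [← Nat.card_eq_fintype_card, hm] at h
    exact congrArg Subtype.val h
  have hcoeff : ∀ i, g.coeff i ∈ K := fun i ↦ by
    by_cases h : g.coeff i = 0
    · rw [h]; exact K.zero_mem
    · exact hK (.inr (coeff_mem_coeffs h))
  have : Fact (Irreducible g) := ⟨hg⟩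
  let L := AdjoinRoot g
  let φ : F →+* L := AdjoinRoot.of g
  let α : L := AdjoinRoot.root g
  have : CharP L p := charP_of_injective_ringHom φ.injective p
  have descend : ∀ x : L, x ^ (p ^ n) ^ m = x → ∃ y : F, φ y = x := fun x hx ↦ by
    obtain ⟨y, hy⟩ := FiniteField.mem_range_of_pow_natCard_eq (φ.comp K.subtype) (hm ▸ hx)
    exact ⟨y, hy⟩
  have hgα : g.eval₂ φ α = 0 := AdjoinRoot.eval₂_root g
  have hα : α ^ p ^ n = α + φ a := by
    have h := eval₂_eq_zero_of_dvd_of_eval₂_eq_zero φ α hdvd hgα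
    simp only [eval₂_sub, eval₂_pow, eval₂_X, eval₂_C] at h
    linear_combination h
  set c : F := ∑ i ∈ Finset.range m, a ^ (p ^ n) ^ i with hc
  have hcK : c ∈ K := K.sum_mem fun i _ ↦ K.pow_mem haK _
  have hαc : α ^ (p ^ n) ^ m = α + φ c := by
    rw [pow_pow_eq_add_sum p n hα m, hc]
    simp
  have hc0 : c ≠ 0 := fun h ↦ by
    rw [h, map_zero, add_zero] at hαc
    obtain ⟨y, hy⟩ := descend α hαc
    refine hnoroot y (φ.injective ?_)
    rw [map_sub, map_pow, hy, hα, add_sub_cancel_left]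
  have hcQ : φ c ^ (p ^ n) ^ m = φ c := by rw [← map_pow, hpow c hcK]
  apply le_antisymm
  · obtain ⟨b, hb⟩ := descend (α ^ p - φ c ^ (p - 1) * α) <| by
      rw [← pow_mul, sub_pow_expChar_pow, mul_pow, pow_right_comm, pow_right_comm (φ c), pow_mul,
        hαc, hcQ, add_pow_expChar]
      have : φ c ^ p = φ c ^ (p - 1) * φ c := (pow_sub_one_mul hp.ne_zero _).symm
      rw [this]
      ring
    let h : F[X] := X ^ p - (C (c ^ (p - 1)) * X + C b)
    have hlt : (C (c ^ (p - 1)) * X + C b).degree < (p : WithBot ℕ) :=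
      degree_linear_le.trans_lt (by exact_mod_cast hp.one_lt)
    have hdeg : h.natDegree = p := by
      refine natDegree_eq_of_degree_eq_some ?_
      rw [degree_sub_eq_left_of_degree_lt (by rwa [degree_X_pow]), degree_X_pow]
    have hgh : g ∣ h := by
      rw [← AdjoinRoot.mk_eq_zero, ← AdjoinRoot.aeval_eq, aeval_def]
      simp only [h, eval₂_sub, eval₂_add, eval₂_mul, eval₂_pow, eval₂_X, eval₂_C]
      change α ^ p - (φ (c ^ (p - 1)) * α + φ b) = 0
      rw [hb, map_pow]
      ring
    exact hdeg ▸ natDegree_le_of_dvd hgh (fun h0 ↦ hp.ne_zero (by rw [← hdeg, h0, natDegree_zero]))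
  · have hroot : ∀ i : ℕ, g.eval₂ φ (α + i * φ c) = 0 := fun i ↦ by
      induction i with
      | zero => simpa using hgα
      | succ i ih =>
        have h := eval₂_pow_eq_zero p (n * m) φ
          (fun i ↦ by rw [pow_mul, hpow _ (hcoeff i)]) ih
        have hi : (i : L) ^ (p ^ n) ^ m = i := by
          rw [← pow_mul, ← iterateFrobenius_def, map_natCast]
        rw [add_pow_expChar_pow, mul_pow, pow_mul, hαc, hcQ, hi] at h
        convert h using 2
        push_cast
        ring
    have hinj : Set.InjOn (fun i : ℕ ↦ α + i * φ c) (Finset.range p) := fun i hi j hj hij ↦ by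
      have h := mul_right_cancel₀ ((map_ne_zero φ).2 hc0) (add_left_cancel hij)
      exact CharP.natCast_injOn_Iio L p (by simpa using hi) (by simpa using hj) h
    classical
    have h := card_le_degree_of_subset_roots (p := g.map φ)
      (Z := (Finset.range p).image fun i : ℕ ↦ α + i * φ c) fun x hx ↦ by
        obtain ⟨i, -, rfl⟩ := Finset.mem_image.1 (Finset.mem_def.2 hx)
        rw [mem_roots (map_ne_zero hg.ne_zero), IsRoot, eval_map]
        exact hroot i
    rwa [Finset.card_image_of_injOn hinj, Finset.card_range, natDegree_map] at h
end

section
/- Let F be a field of prime characteristic p containing a subfield E with p^n elements, n ≥ 1, and suppose q(X) = X^{p^n} − X − a ∈ F[X] is irreducible. Let K = F[α] be the splitting field of q over F, where α is a root of q. Then K/F is a Galois extension of degree p^n whose Galois group is an elementary abelian p-group of order p^n; more precisely, the map b ↦ σ_b, where σ_b is the F-automorphism of K with σ_b(α) = α + b, is a group isomorphism from the additive group of E onto Gal(K/F). -/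
open Polynomial

/-- A field extension generated by one algebraic element `x` has an automorphism sending `x` to any
given root in it of the minimal polynomial of `x`. -/
theorem exists_algEquiv_apply_eq_of_adjoin_eq_top {F K : Type*} [Field F] [Field K] [Algebra F K]
    {x y : K} (hx : IsIntegral F x) (hgen : Algebra.adjoin F {x} = ⊤)
    (hy : aeval y (minpoly F x) = 0) : ∃ σ : K ≃ₐ[F] K, σ x = y := by
  let pb := PowerBasis.ofAdjoinEqTop hx hgen
  have hpb : pb.gen = x := PowerBasis.ofAdjoinEqTop_gen hx hgen
  have : FiniteDimensional F K := pb.finite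
  have hy' : aeval y (minpoly F pb.gen) = 0 := by rwa [hpb]
  refine ⟨(Algebra.IsAlgebraic.algEquivEquivAlgHom F K).symm (pb.lift y hy'), ?_⟩
  exact (congrArg (pb.lift y hy') hpb.symm).trans (pb.lift_gen y hy')

/-- Automorphisms agree if they agree on a generator. -/
theorem algEquiv_ext_of_adjoin_eq_top {F K : Type*} [Field F] [Field K] [Algebra F K]
    {x : K} (hgen : Algebra.adjoin F {x} = ⊤) {σ τ : K ≃ₐ[F] K} (h : σ x = τ x) : σ = τ := by
  have key : (σ : K →ₐ[F] K) = τ :=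
    AlgHom.ext_of_adjoin_eq_top hgen (by simpa [Set.EqOn] using h)
  exact AlgEquiv.ext fun z => DFunLike.congr_fun key z

/-- Translating a root of `X ^ p ^ n - X - C a` by a fixed point of the `p ^ n`-power map gives a
root. -/
theorem aeval_add_algebraMap_eq_zero_of_pow_eq {F K : Type*} [Field F] [Field K] [Algebra F K]
    (p : ℕ) [Fact p.Prime] [CharP F p] {n : ℕ} {a b : F} {x : K}
    (hx : aeval x (X ^ p ^ n - X - C a : F[X]) = 0) (hb : b ^ p ^ n = b) :
    aeval (x + algebraMap F K b) (X ^ p ^ n - X - C a : F[X]) = 0 := by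
  have : CharP K p := charP_of_injective_algebraMap (algebraMap F K).injective p
  simp only [map_sub, map_pow, aeval_X, aeval_C] at hx ⊢
  rw [add_pow_char_pow, ← map_pow, hb]
  linear_combination hx

/-- Let `F` have prime characteristic `p` and contain a subfield `E` with `p^n` elements,
`n ≥ 1`, and suppose `q(X) = X^{p^n} - X - a ∈ F[X]` is irreducible.  Let `K = F[α]` where
`α` is a root of `q` (so `K` is a splitting field of `q` over `F`).  Then `K/F` is a Galois
extension of degree `p^n`, its Galois group is an elementary abelian `p`-group, and
`b ↦ σ_b`, where `σ_b(α) = α + b`, is a group isomorphism from the additive group of `E`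
onto `Gal(K/F)`. -/
theorem stmt14 {F K : Type*} [Field F] [Field K] [Algebra F K]
    (p : ℕ) [Fact p.Prime] [CharP F p]
    (n : ℕ) (hn : 1 ≤ n) (E : Subfield F) (hE : Nat.card E = p ^ n) (a : F)
    (hirr : Irreducible (X ^ p ^ n - X - C a : Polynomial F))
    (α : K) (hα : (Polynomial.aeval α) (X ^ p ^ n - X - C a : Polynomial F) = 0)
    (hgen : Algebra.adjoin F {α} = ⊤) :
    IsGalois F K ∧ Module.finrank F K = p ^ n ∧
    (∀ σ : K ≃ₐ[F] K, σ ^ p = 1) ∧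
    (∀ σ τ : K ≃ₐ[F] K, σ * τ = τ * σ) ∧
    ∃ φ : Multiplicative E ≃* (K ≃ₐ[F] K),
      ∀ b : E, φ (Multiplicative.ofAdd b) α = α + algebraMap F K (b : F) := by
  have hp : p.Prime := Fact.out
  have h1 : 1 < p ^ n := Nat.one_lt_pow (by omega) hp.one_lt
  have hdeg : (X + C a : F[X]).degree < (p ^ n : ℕ) := by
    rw [degree_X_add_C]; exact_mod_cast h1
  have hq : (X ^ p ^ n - X - C a : F[X]) = X ^ p ^ n - (X + C a) := by ring
  have hmonic : (X ^ p ^ n - X - C a : F[X]).Monic := by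
    rw [hq]; exact monic_X_pow_sub hdeg
  have hmin := minpoly.eq_of_irreducible_of_monic hirr hα hmonic
  have hint : IsIntegral F α := ⟨_, hmonic, hα⟩
  have : FiniteDimensional F K := (PowerBasis.ofAdjoinEqTop hint hgen).finite
  have hrank : Module.finrank F K = p ^ n := by
    rw [(PowerBasis.ofAdjoinEqTop hint hgen).finrank, ← PowerBasis.natDegree_minpoly,
      PowerBasis.ofAdjoinEqTop_gen, ← hmin, hq]
    apply natDegree_eq_of_degree_eq_some
    rw [degree_sub_eq_left_of_degree_lt (by rwa [degree_X_pow]), degree_X_pow]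
  have : Finite E := Nat.finite_of_card_ne_zero (by omega)
  have hE_pow (b : E) : (b : F) ^ p ^ n = b := by
    have : Fintype E := Fintype.ofFinite E
    have h := FiniteField.pow_card b
    rw [← Nat.card_eq_fintype_card, hE] at h
    exact_mod_cast congrArg Subtype.val h
  have hex (b : E) : ∃ σ : K ≃ₐ[F] K, σ α = α + algebraMap F K b :=
    exists_algEquiv_apply_eq_of_adjoin_eq_top hint hgen
      (hmin ▸ aeval_add_algebraMap_eq_zero_of_pow_eq p hα (hE_pow b))
  choose σ hσ using hex
  let φ : Multiplicative E →* (K ≃ₐ[F] K) := MonoidHom.mk' (fun b => σ b.toAdd) fun b c => by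
    apply algEquiv_ext_of_adjoin_eq_top hgen
    rw [AlgEquiv.mul_apply, hσ, hσ, map_add, hσ, AlgEquiv.commutes, toAdd_mul, Subfield.coe_add,
      map_add, add_assoc]
  have hφ (b : E) : φ (Multiplicative.ofAdd b) α = α + algebraMap F K b := hσ b
  have hinj : Function.Injective φ := fun b c h => by
    have h' : φ (Multiplicative.ofAdd b.toAdd) α = φ (Multiplicative.ofAdd c.toAdd) α :=
      DFunLike.congr_fun h α
    rw [hφ, hφ, add_right_inj] at h'
    exact Multiplicative.toAdd.injective (Subtype.ext ((algebraMap F K).injective h'))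
  have hcardE : Nat.card (Multiplicative E) = p ^ n := hE
  have hle : Nat.card (K ≃ₐ[F] K) ≤ Nat.card (Multiplicative E) := by
    rw [hcardE, ← hrank, Nat.card_eq_fintype_card]
    exact AlgEquiv.card_le
  have hbij : Function.Bijective φ := (Nat.bijective_iff_injective_and_card φ).2
    ⟨hinj, le_antisymm (Nat.card_le_card_of_injective φ hinj) hle⟩
  have hcomm (τ υ : K ≃ₐ[F] K) : τ * υ = υ * τ := by
    obtain ⟨b, rfl⟩ := hbij.2 τ
    obtain ⟨c, rfl⟩ := hbij.2 υ
    rw [← map_mul, mul_comm, map_mul]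
  have hpow (τ : K ≃ₐ[F] K) : τ ^ p = 1 := by
    obtain ⟨b, rfl⟩ := hbij.2 τ
    have hb : b ^ p = 1 := by
      apply Multiplicative.toAdd.injective
      apply Subtype.ext
      simp
    rw [← map_pow, hb, map_one]
  refine ⟨IsGalois.of_card_aut_eq_finrank F K ?_, hrank, hpow, hcomm,
    MulEquiv.ofBijective φ hbij, hφ⟩
  rw [← Nat.card_eq_of_bijective φ hbij, hcardE, hrank]
end

section
/- Let p be a prime, n ≥ 1, and let R be an 𝔽_p-subspace of the field 𝔽_{p^n}. Define f_R(Y) = ∏_{b∈R} (Y + b) ∈ 𝔽_{p^n}[Y]. Then all coefficients of f_R lie in the prime field 𝔽_p if and only if R is invariant under the Frobenius automorphism b ↦ b^p of 𝔽_{p^n}. -/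
open Polynomial

/-- Let `F` be a field with `p^n` elements (`p` prime, `n ≥ 1`) and let `R` be an
`𝔽_p`-subspace of `F`, i.e. an additive subgroup (in characteristic `p` every additive
subgroup is automatically closed under multiplication by elements of the prime field).
Set `f_R(Y) = ∏_{b ∈ R} (Y + b)`.  Then all coefficients of `f_R` lie in the prime field
`𝔽_p` (i.e. each coefficient `c` satisfies `c^p = c`) if and only if `R` is invariant under
the Frobenius automorphism `b ↦ b^p`. -/
theorem stmt16 (p : ℕ) [Fact p.Prime] (n : ℕ) (hn : 1 ≤ n)
    {F : Type*} [Field F] [Fintype F] [CharP F p] (hF : Fintype.card F = p ^ n)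
    (R : AddSubgroup F) :
    (∀ k : ℕ,
      ((∏ b ∈ (Set.toFinite (R : Set F)).toFinset, (X + C b)).coeff k) ^ p =
        (∏ b ∈ (Set.toFinite (R : Set F)).toFinset, (X + C b)).coeff k) ↔
    (∀ b ∈ R, b ^ p ∈ R) := by
  set s := (Set.toFinite (R : Set F)).toFinset with hs
  have mem_s : ∀ b, b ∈ s ↔ b ∈ R := fun b => by simp [hs]
  have map_eq_iff : (∀ k : ℕ, ((∏ b ∈ s, (X + C b)).coeff k) ^ p = (∏ b ∈ s, (X + C b)).coeff k) ↔
      (∏ b ∈ s, (X + C b)).map (frobenius F p) = ∏ b ∈ s, (X + C b) := by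
    rw [Polynomial.ext_iff]
    simp only [coeff_map, frobenius_def]
  rw [map_eq_iff]
  constructor
  · intro h b hb
    have hroot : (∏ c ∈ s, (X + C c)).eval (-b) = 0 := by
      rw [eval_prod]
      exact Finset.prod_eq_zero ((mem_s b).2 hb) (by simp)
    have hfrob : (∏ c ∈ s, (X + C c)).eval (frobenius F p (-b)) = 0 := by
      rw [← h, eval_map_apply, hroot, map_zero]
    rw [eval_prod, Finset.prod_eq_zero_iff] at hfrob
    obtain ⟨c, hc, hbc⟩ := hfrob
    rw [eval_add, eval_X, eval_C, map_neg, frobenius_def, neg_add_eq_zero] at hbc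
    exact hbc ▸ (mem_s c).1 hc
  · intro h
    have hmap : s.map ⟨frobenius F p, frobenius_inj F p⟩ = s := by
      refine Finset.eq_of_subset_of_card_le (fun x hx => ?_) (Finset.card_map _).ge
      obtain ⟨b, hb, rfl⟩ := Finset.mem_map.1 hx
      exact (mem_s _).2 (h b ((mem_s b).1 hb))
    conv_rhs => rw [← hmap, Finset.prod_map]
    simp [Polynomial.map_prod]
end

section
/- Let K be a field of prime characteristic p, let X and Z be algebraically independent over K, and set F = K(Z), the field of rational functions. Let n ≥ 1, e ≥ 0, r ≥ 1 be integers and let g(Z) = c_d Z^d + ⋯ + c_1 Z + c_0 ∈ K[Z] be a polynomial whose degree d is coprime to p. Then h(X) = X^{p^{n+e}} − X^{p^e} − g(Z^r) is irreducible in F[X] if and only if at least one of the following holds: (i) p does not divide r; (ii) e = 0; (iii) g(Z) ∉ K^p[Z], i.e., some coefficient of g is not a p-th power in K. In particular (taking e = 0), X^{p^n} − X − g(Z^r) is irreducible in F[X] for every n ≥ 1 and r ≥ 1, and (taking g(Z) = Z, r = 1) X^{p^n} − X − Z is irreducible in F[X]. -/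
open Polynomial
open scoped IntermediateField

/-- The `L`-algebra map `L[Z][X] → L[X][T]` given by `Z ↦ T ^ q`, `X ↦ X * T ^ m`: its degree in `T`
is the weighted degree in which `Z` has weight `q` and `X` has weight `m`. -/
noncomputable def weightHom (L : Type*) [CommRing L] (q m : ℕ) : L[X][X] →+* L[X][X] :=
  eval₂RingHom (eval₂RingHom (C.comp C) (X ^ q)) (C X * X ^ m)

lemma coeff_coeff_weightHom {L : Type*} [CommRing L] (q m : ℕ) (P : L[X][X])
    (N i : ℕ) :
    ((weightHom L q m P).coeff N).coeff i = (expand L q (P.coeff i) * X ^ (m * i)).coeff N := by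
  induction P using Polynomial.induction_on' with
  | add P Q hP hQ => simp [hP, hQ, add_mul]
  | monomial k a =>
    induction a using Polynomial.induction_on' with
    | add a b ha hb => simp only [map_add, coeff_add, ha, hb, add_mul]
    | monomial j c =>
      have : weightHom L q m (monomial k (monomial j c)) =
          monomial (q * j + m * k) (monomial k c) := by
        simp only [weightHom, coe_eval₂RingHom, eval₂_monomial, RingHom.comp_apply]
        simp only [← C_mul_X_pow_eq_monomial, map_mul, map_pow]
        ring
      rw [this]
      by_cases hk : k = i
      · subst hk
        simp [coeff_monomial, expand_monomial, mul_comm]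
        split_ifs <;> simp
      · simp only [coeff_monomial]
        split_ifs <;> simp [coeff_monomial, hk]

lemma weightHom_leadingCoeff_eq_monomial {L : Type*} [CommRing L] {q m : ℕ} (hq : 0 < q)
    (hm : Nat.Coprime m q) (P : L[X][X]) (hP : P.natDegree < q) :
    ∃ i c, (weightHom L q m P).leadingCoeff = monomial i c := by
  have key : ∀ i, (weightHom L q m P).leadingCoeff.coeff i ≠ 0 → i < q ∧
      m * i ≡ (weightHom L q m P).natDegree [MOD q] := by
    intro i hi
    rw [leadingCoeff, coeff_coeff_weightHom, coeff_mul_X_pow'] at hi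
    split_ifs at hi with h
    · rw [coeff_expand hq] at hi
      split_ifs at hi with h'
      · refine ⟨lt_of_le_of_lt (le_natDegree_of_ne_zero fun h0 ↦ hi ?_) hP,
          (Nat.modEq_iff_dvd' h).2 h'⟩
        simp [h0]
      · exact absurd rfl hi
    · exact absurd rfl hi
  set A := (weightHom L q m P).leadingCoeff
  refine ⟨A.natDegree, A.leadingCoeff, ?_⟩
  by_cases hA : A = 0
  · simp [hA]
  ext i
  rw [coeff_monomial]
  split_ifs with h
  · rw [← h]; rfl
  · by_contra hi
    obtain ⟨h1, h2⟩ := key i hi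
    obtain ⟨h3, h4⟩ := key A.natDegree (by simpa using hA)
    exact h (Nat.ModEq.eq_of_lt_of_lt
      (Nat.ModEq.cancel_left_of_coprime (hm.symm) (h4.trans h2.symm)) h3 h1)

lemma monic_X_pow_sub_X_sub_C {R : Type*} [CommRing R] [Nontrivial R] {q : ℕ} (hq : 1 < q)
    (a : R) : (X ^ q - X - C a).Monic ∧ (X ^ q - X - C a).natDegree = q := by
  have h : (X + C a).degree < (q : WithBot ℕ) := by
    rw [degree_X_add_C]; exact_mod_cast hq
  rw [sub_sub]
  refine ⟨monic_X_pow_sub (by simpa using hq), ?_⟩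
  rw [natDegree_sub_eq_left_of_natDegree_lt] <;> simp [hq]

lemma weightHom_X_pow_sub_X_sub_C_leadingCoeff {L : Type*} [CommRing L] [IsDomain L] {q : ℕ}
    (hq : 1 < q) (H : L[X]) (hH : 0 < H.natDegree) :
    (weightHom L q H.natDegree (X ^ q - X - C H)).leadingCoeff = X ^ q - C H.leadingCoeff := by
  have e : weightHom L q H.natDegree (X ^ q - X - C H) =
      C (X ^ q) * X ^ (q * H.natDegree) - C X * X ^ H.natDegree -
        (expand L q H).map C := by
    have : ∀ G : L[X], eval₂ (C.comp C) (X ^ q) G = (expand L q G).map (C : L →+* L[X]) := by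
      intro G
      rw [expand_eq_sum, eval₂_eq_sum]
      simp [Polynomial.sum, Polynomial.map_sum]
    simp only [weightHom, coe_eval₂RingHom, eval₂_sub, eval₂_pow, eval₂_X, eval₂_C, this]
    rw [map_pow]; ring
  have hc : (weightHom L q H.natDegree (X ^ q - X - C H)).coeff (q * H.natDegree) =
      X ^ q - C H.leadingCoeff := by
    have h1 : q * H.natDegree ≠ H.natDegree := by nlinarith
    rw [e, coeff_sub, coeff_sub, coeff_C_mul_X_pow, coeff_C_mul_X_pow, if_pos rfl, if_neg h1,
      coeff_map, coeff_expand_mul' (by omega), sub_zero]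
    rfl
  have hd : (weightHom L q H.natDegree (X ^ q - X - C H)).natDegree ≤ q * H.natDegree := by
    rw [e]
    refine (natDegree_sub_le_of_le (natDegree_sub_le_of_le (natDegree_C_mul_X_pow_le _ _)
      (natDegree_C_mul_X_pow_le _ _)) (natDegree_map_le.trans (natDegree_expand _ _).le)).trans ?_
    simp only [max_le_iff]
    refine ⟨⟨le_rfl, by nlinarith⟩, by rw [mul_comm]⟩
  have h0 : (X ^ q - C H.leadingCoeff : L[X]) ≠ 0 := X_pow_sub_C_ne_zero (by omega) _
  rw [leadingCoeff, le_antisymm hd (le_natDegree_of_ne_zero (by rwa [hc])), hc]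

/-- Over `L[Z]`, the polynomial `X ^ q - X - H(Z)` is irreducible as soon as the degree of `H` is
positive and coprime to `q`. -/
lemma irreducible_X_pow_sub_X_sub_C_of_coprime {L : Type*} [CommRing L] [IsDomain L] {q : ℕ}
    (hq : 1 < q) (H : L[X]) (hH : 0 < H.natDegree) (hc : H.natDegree.Coprime q) :
    Irreducible (X ^ q - X - C H : L[X][X]) := by
  obtain ⟨hmon, hdeg⟩ := monic_X_pow_sub_X_sub_C hq H
  rw [hmon.irreducible_iff_natDegree']
  refine ⟨fun h ↦ by simp [h] at hdeg; omega, fun a b ha hb hab hmem ↦ ?_⟩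
  rw [hdeg, Finset.mem_Ioc] at hmem
  have hsum : a.natDegree + b.natDegree = q := by rw [← ha.natDegree_mul hb, hab, hdeg]
  obtain ⟨i, u, hi⟩ := weightHom_leadingCoeff_eq_monomial (by omega) hc a (by omega)
  obtain ⟨j, v, hj⟩ := weightHom_leadingCoeff_eq_monomial (by omega) hc b (by omega)
  have h := weightHom_X_pow_sub_X_sub_C_leadingCoeff hq H hH
  rw [← hab, map_mul, leadingCoeff_mul, hi, hj, monomial_mul_monomial] at h
  have hH0 : H.leadingCoeff ≠ 0 := leadingCoeff_ne_zero.2 fun h ↦ by simp [h] at hH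
  have h0 := congrArg (coeff · 0) h
  have hq' := congrArg (coeff · q) h
  have hq0 : q ≠ 0 := by omega
  simp only [coeff_monomial, coeff_sub, coeff_X_pow, coeff_C, hq0, hq0.symm, if_true, if_false,
    sub_zero, zero_sub] at h0 hq'
  split_ifs at h0 hq' with h1 h2 <;> simp_all

lemma irreducible_X_pow_sub_X_sub_C_pow {F : Type*} [Field F] (p : ℕ) [Fact p.Prime] [CharP F p]
    {n : ℕ} (hn : 1 ≤ n) (s : ℕ) {a : F} (h : Irreducible (X ^ p ^ n - X - C a)) :
    Irreducible (X ^ p ^ n - X - C (a ^ p ^ s)) := by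
  have hq : 1 < p ^ n := Nat.one_lt_pow (by omega) (Fact.out : p.Prime).one_lt
  obtain ⟨hmon, hdeg⟩ := monic_X_pow_sub_X_sub_C hq a
  obtain ⟨hmon', hdeg'⟩ := monic_X_pow_sub_X_sub_C hq (a ^ p ^ s)
  have := Fact.mk h
  have : CharP (AdjoinRoot (X ^ p ^ n - X - C a)) p :=
    charP_of_injective_algebraMap (algebraMap F _).injective p
  set x := AdjoinRoot.root (X ^ p ^ n - X - C a) with hx
  have hroot : aeval x (X ^ p ^ n - X - C a) = 0 := by
    rw [hx, AdjoinRoot.aeval_eq, AdjoinRoot.mk_self]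
  have hmin : X ^ p ^ n - X - C a = minpoly F x :=
    minpoly.eq_of_irreducible_of_monic h hroot hmon
  have hint : IsIntegral F x := ⟨_, hmon, hroot⟩
  have hsep : IsSeparable F x := by
    rw [IsSeparable, ← hmin]
    refine ⟨0, -1, ?_⟩
    have : ((p ^ n : ℕ) : F[X]) = 0 := by
      rw [Nat.cast_pow, CharP.cast_eq_zero, zero_pow (by omega)]
    simp [derivative_X_pow, CharP.cast_eq_zero, zero_pow (by omega : n ≠ 0)]
  have hadj := IntermediateField.adjoin_simple_eq_adjoin_pow_expChar_pow_of_isSeparable F _ hsep p s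
  have hdeg2 : (minpoly F (x ^ p ^ s)).natDegree = p ^ n := by
    rw [← IntermediateField.adjoin.finrank (hint.pow _), ← hadj,
      IntermediateField.adjoin.finrank hint, ← hmin, hdeg]
  have hroot2 : aeval (x ^ p ^ s) (X ^ p ^ n - X - C (a ^ p ^ s)) = 0 := by
    have := congrArg (· ^ p ^ s) hroot
    simp only [map_sub, map_pow, aeval_X, aeval_C, sub_pow_char_pow,
      zero_pow (pow_pos (Fact.out : p.Prime).pos s).ne'] at this ⊢
    rw [← this, pow_right_comm]
  have heq := eq_of_monic_of_dvd_of_natDegree_le (minpoly.monic (hint.pow _)) hmon'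
    (minpoly.dvd F _ hroot2) (by rw [hdeg', hdeg2])
  rw [heq]
  exact minpoly.irreducible (hint.pow _)

lemma irreducible_X_pow_sub_X_sub_C_comp {K : Type*} [Field K] (p : ℕ) [Fact p.Prime] [CharP K p]
    {n r : ℕ} (hn : 1 ≤ n) (hr : 1 ≤ r) (g : K[X]) (hd : g.natDegree.Coprime p) :
    Irreducible (X ^ p ^ n - X - C (algebraMap K[X] (RatFunc K) (g.comp (X ^ r)))) := by
  have hp : p.Prime := Fact.out
  have hq : 1 < p ^ n := Nat.one_lt_pow (by omega) hp.one_lt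
  have hmap (L : Type _) [Field L] (G : L[X]) :
      Irreducible (X ^ p ^ n - X - C G : L[X][X]) ↔
      Irreducible (X ^ p ^ n - X - C (algebraMap L[X] (RatFunc L) G)) := by
    rw [(monic_X_pow_sub_X_sub_C hq G).1.irreducible_iff_irreducible_map_fraction_map
      (K := RatFunc L)]
    simp
  rw [← hmap]
  let L := AlgebraicClosure K
  have : CharP L p := charP_of_injective_algebraMap (algebraMap K L).injective p
  refine (monic_X_pow_sub_X_sub_C hq _).1.irreducible_of_irreducible_map
    (mapRingHom (algebraMap K L)) _ ?_
  obtain ⟨s, t, ht, rfl⟩ := Nat.exists_eq_pow_mul_and_not_dvd (by omega : r ≠ 0) p hp.ne_one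
  have ht0 : 0 < t := Nat.pos_of_ne_zero fun h ↦ ht (h ▸ dvd_zero p)
  let g' : L[X] := (g.map (algebraMap K L)).map (iterateFrobeniusEquiv L p s).symm.toRingHom
  have hg' : g'.map (iterateFrobenius L p s) = g.map (algebraMap K L) := by
    ext k
    simp only [g', coeff_map]
    exact (iterateFrobeniusEquiv L p s).apply_symm_apply _
  have hdg : g'.natDegree = g.natDegree := by
    simp only [g', natDegree_map]
  have hG : (g.comp (X ^ (p ^ s * t))).map (algebraMap K L) = (expand L t g') ^ p ^ s := by
    rw [← map_iterateFrobenius_expand, map_expand, map_expand, hg', expand_expand,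
      ← expand_eq_comp_X_pow, map_expand]
  simp only [Polynomial.map_sub, Polynomial.map_pow, map_X, map_C, coe_mapRingHom, hG]
  have : CharP (RatFunc L) p := charP_of_injective_algebraMap (algebraMap L (RatFunc L)).injective p
  rw [hmap, map_pow]
  refine irreducible_X_pow_sub_X_sub_C_pow p hn s ?_
  rw [← hmap]
  have h0 : g.natDegree ≠ 0 := fun h ↦ by
    rw [h, Nat.coprime_zero_left] at hd; exact hp.ne_one hd
  refine irreducible_X_pow_sub_X_sub_C_of_coprime hq _ ?_ ?_
  · rw [natDegree_expand, hdg]; positivity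
  · rw [natDegree_expand, hdg]
    exact Nat.Coprime.pow_right _ (hd.mul_left ((hp.coprime_iff_not_dvd.2 ht).symm))

lemma irreducible_comp_X_pow_char {F : Type*} [Field F] (p : ℕ) [Fact p.Prime] [CharP F p]
    {f : F[X]} (hm : f.Monic) (hf : Irreducible f) (h0 : ∀ c, f.coeff 0 ≠ c ^ p) :
    Irreducible (f.comp (X ^ p)) := by
  have hp : p.Prime := Fact.out
  refine irreducible_comp hm (monic_X_pow p) hf fun E _ _ x hx ↦ ?_
  rw [Polynomial.map_pow, map_X]
  refine X_pow_sub_C_irreducible_of_prime hp fun b hb ↦ ?_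
  have hint : IsIntegral F x := by
    by_contra h
    rw [minpoly.eq_zero h] at hx
    exact hf.ne_zero hx.symm
  have := IntermediateField.adjoin.finiteDimensional hint
  have : CharP F⟮x⟯ p := charP_of_injective_algebraMap (algebraMap F _).injective p
  have hbint : IsIntegral F b := IsIntegral.of_finite F b
  have hroot : aeval (IntermediateField.AdjoinSimple.gen F x)
      ((minpoly F b).map (frobenius F p)) = 0 := by
    have h1 : expand F p ((minpoly F b).map (frobenius F p)) = minpoly F b ^ p := by
      rw [← map_expand, map_frobenius_expand]
    rw [← hb, ← expand_aeval, h1, map_pow, minpoly.aeval, zero_pow hp.ne_zero]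
  have hdvd := minpoly.dvd F _ hroot
  rw [IntermediateField.minpoly_gen, hx] at hdvd
  have heq := eq_of_monic_of_dvd_of_natDegree_le hm ((minpoly.monic hbint).map _) hdvd (by
    rw [natDegree_map, ← hx, ← IntermediateField.adjoin.finrank hint]
    exact minpoly.natDegree_le b)
  refine h0 ((minpoly F b).coeff 0) ?_
  rw [← heq, coeff_map, frobenius_def]

lemma comp_X_pow_eq_pow_iff {K : Type*} [Field K] (p : ℕ) [Fact p.Prime] [CharP K p]
    {r : ℕ} (hr : 1 ≤ r) (g : K[X]) (hd : g.natDegree.Coprime p) :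
    (∃ w, algebraMap K[X] (RatFunc K) (g.comp (X ^ r)) = w ^ p) ↔
      p ∣ r ∧ ∀ k, ∃ c, g.coeff k = c ^ p := by
  have hp : p.Prime := Fact.out
  rw [← expand_eq_comp_X_pow]
  constructor
  · rintro ⟨w, hw⟩
    obtain ⟨y, rfl⟩ := IsIntegrallyClosed.exists_algebraMap_eq_of_isIntegral_pow (R := K[X])
      hp.pos (hw ▸ isIntegral_algebraMap)
    rw [← map_pow] at hw
    replace hw := IsFractionRing.injective K[X] (RatFunc K) hw
    have hdvd : p ∣ r := by
      have := congrArg natDegree hw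
      rw [natDegree_expand, natDegree_pow] at this
      exact (hd.symm).dvd_of_dvd_mul_left (this ▸ dvd_mul_right _ _)
    obtain ⟨t, rfl⟩ := hdvd
    refine ⟨dvd_mul_right _ _, fun k ↦ ⟨y.coeff (k * t), ?_⟩⟩
    have := congrArg (coeff · (k * (p * t))) hw
    rw [coeff_expand_mul (by omega), ← map_frobenius_expand, coeff_map,
      show k * (p * t) = k * t * p by ring, coeff_expand_mul hp.pos, frobenius_def] at this
    exact this
  · rintro ⟨⟨t, rfl⟩, hc⟩
    obtain ⟨g', hg'⟩ : ∃ g' : K[X], g'.map (frobenius K p) = g :=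
      (mem_map_range _).2 fun k ↦ (hc k).imp fun c h ↦ h.symm
    refine ⟨algebraMap _ _ (expand K t g'), ?_⟩
    rw [← map_pow, ← map_frobenius_expand, map_expand, map_expand, hg', expand_expand]

/-- Let `K` be a field of prime characteristic `p`, `F = K(Z)` the field of rational
functions, `n ≥ 1`, `e ≥ 0`, `r ≥ 1`, and let `g ∈ K[Z]` be a nonzero polynomial whose
degree is coprime to `p`.  Then `h(X) = X^{p^{n+e}} - X^{p^e} - g(Z^r)` is irreducible in
`F[X]` if and only if (i) `p ∤ r`, or (ii) `e = 0`, or (iii) some coefficient of `g` is not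
a `p`-th power in `K`.  In particular, `X^{p^{n'}} - X - g(Z^{r'})` is irreducible in `F[X]`
for all `n' ≥ 1`, `r' ≥ 1`, and `X^{p^{n'}} - X - Z` is irreducible in `F[X]`. -/
theorem stmt19 {K : Type*} [Field K] (p : ℕ) [Fact p.Prime] [CharP K p]
    (n e r : ℕ) (hn : 1 ≤ n) (hr : 1 ≤ r)
    (g : Polynomial K) (hg : g ≠ 0) (hd : Nat.Coprime g.natDegree p) :
    (Irreducible (X ^ p ^ (n + e) - X ^ p ^ e -
        C (algebraMap (Polynomial K) (RatFunc K) (g.comp (X ^ r))) :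
        Polynomial (RatFunc K)) ↔
      (¬ p ∣ r ∨ e = 0 ∨ ∃ k : ℕ, ∀ c : K, g.coeff k ≠ c ^ p)) ∧
    (∀ n' r' : ℕ, 1 ≤ n' → 1 ≤ r' →
      Irreducible (X ^ p ^ n' - X -
        C (algebraMap (Polynomial K) (RatFunc K) (g.comp (X ^ r'))) :
        Polynomial (RatFunc K))) ∧
    (∀ n' : ℕ, 1 ≤ n' →
      Irreducible (X ^ p ^ n' - X -
        C (algebraMap (Polynomial K) (RatFunc K) X) :
        Polynomial (RatFunc K))) := by
  have hp : p.Prime := Fact.out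
  have : CharP (RatFunc K) p := charP_of_injective_algebraMap (algebraMap K (RatFunc K)).injective p
  refine ⟨⟨fun h ↦ ?_, fun h ↦ ?_⟩, fun n' r' hn' hr' ↦
    irreducible_X_pow_sub_X_sub_C_comp p hn' hr' g hd, fun n' hn' ↦ ?_⟩
  · by_contra! hcon
    obtain ⟨hpr, he, hc⟩ := hcon
    obtain ⟨w, hw⟩ := (comp_X_pow_eq_pow_iff p hr g hd).2 ⟨hpr, hc⟩
    obtain ⟨e, rfl⟩ := Nat.exists_eq_succ_of_ne_zero he
    refine not_irreducible_pow hp.ne_one (?_ : Irreducible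
      ((X ^ p ^ (n + e) - X ^ p ^ e - C w) ^ p))
    rw [hw] at h
    convert h using 1
    rw [sub_pow_char, sub_pow_char, ← pow_mul, ← pow_mul, ← C_pow]
    rfl
  · rcases Nat.eq_zero_or_pos e with rfl | he
    · simpa using irreducible_X_pow_sub_X_sub_C_comp p hn hr g hd
    have hw : ∀ w, algebraMap K[X] (RatFunc K) (g.comp (X ^ r)) ≠ w ^ p := by
      by_contra! hcon
      obtain ⟨h1, h2⟩ := (comp_X_pow_eq_pow_iff p hr g hd).1 hcon
      rcases h with h | h | ⟨k, h⟩
      · exact h h1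
      · omega
      · obtain ⟨c, hc⟩ := h2 k
        exact h c hc
    have h0 := irreducible_X_pow_sub_X_sub_C_comp p hn hr g hd
    generalize algebraMap K[X] (RatFunc K) (g.comp (X ^ r)) = a at *
    clear h he
    induction e with
    | zero => simpa using h0
    | succ e ih =>
      have hlt : p ^ e < p ^ (n + e) := Nat.pow_lt_pow_right hp.one_lt (by omega)
      have hmon : (X ^ p ^ (n + e) - X ^ p ^ e - C a : (RatFunc K)[X]).Monic := by
        rw [sub_sub]
        exact monic_X_pow_sub (by compute_degree; exact Nat.cast_lt.2 hlt)
      have := irreducible_comp_X_pow_char p hmon ih fun c hc ↦ by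
        refine hw (0 - c) ?_
        rw [sub_pow_char, ← hc]
        simp [coeff_X_pow, hp.ne_zero, (pow_pos hp.pos _).ne]
      simpa [← pow_mul, ← pow_succ', ← add_assoc] using this
  · simpa using irreducible_X_pow_sub_X_sub_C_comp p hn' le_rfl X (by simp)
end
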